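/- arXiv:1102.3224 — 2 statements merged into one kernel-verified Lean document; each statement's English description precedes it below -/
import Mathlib

section
/- Let S be a carpet in S², let Ψ : S² → S² be a quasiconformal homeomorphism with Ψ(S) = S, and set ψ := Ψ|_S. Suppose Γ is a path family in S² with Ψ(Γ) = Γ such that for every peripheral circle C of S that meets some path in Γ one has ψⁿ(C) ≠ C for all integers n ≠ 0. Then mod_{S/⟨ψᵏ⟩}(Γ) = k · mod_{S/⟨ψ⟩}(Γ) for every k ∈ ℕ, where ⟨ψ⟩ and ⟨ψᵏ⟩ denote the cyclic groups of homeomorphisms of S generated by ψ and by ψᵏ. -/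
open Set Metric

noncomputable section

/-- Level-`n` approximation `Q_n` of the standard `1/p`-Sierpiński carpet in `ℂ ≅ ℝ²`:
`Q_0` is the closed unit square, and `Q_{n+1}` is the union of the images of `Q_n` under
the `p² - 1` contractions `z ↦ (z + i + j·√-1)/p` with `(i,j)` ranging over all non-middle
positions; this is the usual subdivide-and-remove-middle-squares construction. -/
def carpetApprox (p : ℕ) : ℕ → Set ℂ
  | 0 => {z : ℂ | z.re ∈ Set.Icc (0:ℝ) 1 ∧ z.im ∈ Set.Icc (0:ℝ) 1}
  | n + 1 =>
      ⋃ (i : ℕ) (j : ℕ) (_ : i < p) (_ : j < p)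
        (_ : ¬(i = (p - 1) / 2 ∧ j = (p - 1) / 2)),
        (fun z : ℂ => (z + (i : ℂ) + (j : ℂ) * Complex.I) / (p : ℂ)) '' carpetApprox p n

/-- The standard `1/p`-Sierpiński carpet `S_p ⊆ ℝ² ≅ ℂ`. -/
def sierpinskiCarpet (p : ℕ) : Set ℂ := ⋂ n, carpetApprox p n

/-- `η : [0,∞) → [0,∞)` is a (self-)homeomorphism of `[0,∞)`: it is continuous, strictly
increasing on `[0,∞)`, fixes `0` and maps `[0,∞)` onto `[0,∞)`. -/
def IsQSControl (η : ℝ → ℝ) : Prop :=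
  ContinuousOn η (Set.Ici 0) ∧ StrictMonoOn η (Set.Ici 0) ∧ η 0 = 0 ∧
    Set.SurjOn η (Set.Ici 0) (Set.Ici 0)

/-- A map `f` between metric spaces is quasisymmetric: for some homeomorphism
`η : [0,∞) → [0,∞)` one has `d(f u, f v) ≤ η(d(u,v)/d(u,w)) · d(f u, f w)` for all `u,v,w`
with `u ≠ w`. -/
def IsQSMap {X Y : Type*} [MetricSpace X] [MetricSpace Y] (f : X → Y) : Prop :=
  ∃ η : ℝ → ℝ, IsQSControl η ∧
    ∀ u v w : X, u ≠ w → dist (f u) (f v) ≤ η (dist u v / dist u w) * dist (f u) (f w)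

/-- The boundary of the axis-parallel closed square with lower-left corner `c` and
side length `l`. -/
def squareBoundary (c : ℂ) (l : ℝ) : Set ℂ :=
  {z : ℂ | max |z.re - (c.re + l / 2)| |z.im - (c.im + l / 2)| = l / 2}

/-- The outer square `O = ∂([0,1]×[0,1])`. -/
def outerSquare : Set ℂ := squareBoundary 0 1

/-- The middle square `M = ∂([(p-1)/(2p),(p+1)/(2p)]²)`. -/
def middleSquare (p : ℕ) : Set ℂ :=
  squareBoundary ((((p : ℝ) - 1) / (2 * p) : ℝ) * (1 + Complex.I)) (1 / p)

end

open MeasureTheory Filter Topology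
open scoped ENNReal

noncomputable section

/-- The unit sphere `S² = {x ∈ ℝ³ : |x| = 1}`, with the metric induced from `ℝ³`. -/
def Sphere2 : Set (EuclideanSpace ℝ (Fin 3)) := Metric.sphere 0 1

/-- The `2`-dimensional Hausdorff measure `σ` on `S²`. -/
def sphereMeasure : Measure ↥Sphere2 := μH[2]

/-- A path in `S²`: a continuous map of a finite interval (of one of the four kinds
`[a,b]`, `[a,b)`, `(a,b]`, `(a,b)` with `a < b`) into `S²`. -/
structure SpherePath where
  /-- The parameter interval. -/
  I : Set ℝ
  /-- The parameter set is a finite interval. -/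
  hI : ∃ a b : ℝ, a < b ∧
    (I = Set.Icc a b ∨ I = Set.Ico a b ∨ I = Set.Ioc a b ∨ I = Set.Ioo a b)
  /-- The parametrizing map. -/
  toFun : ℝ → ↥Sphere2
  /-- Continuity on the parameter interval. -/
  cont : ContinuousOn toFun I

/-- The image of a path. -/
def SpherePath.image (γ : SpherePath) : Set ↥Sphere2 := γ.toFun '' γ.I

/-- A path is locally rectifiable if it has finite length (total variation) on every
compact subinterval of its parameter interval. -/
def SpherePath.LocRectifiable (γ : SpherePath) : Prop :=
  ∀ a b : ℝ, Set.Icc a b ⊆ γ.I → eVariationOn γ.toFun (Set.Icc a b) < ⊤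

/-- The arclength integral `∫ ρ ds` of a density `ρ` over the restriction of the curve
`f` to `[a,b]`, computed via the arclength parametrization: if `s(t)` denotes the length
of `f|[a,t]` and `L` the length of `f|[a,b]`, this is `∫₀ᴸ ρ(f(t(u))) du` where
`t(u) = inf{t ∈ [a,b] : s(t) ≥ u}`. -/
def arcIntegralOn (ρ : ↥Sphere2 → ℝ≥0∞) (f : ℝ → ↥Sphere2) (a b : ℝ) : ℝ≥0∞ :=
  ∫⁻ u in Set.Ico (0 : ℝ) (eVariationOn f (Set.Icc a b)).toReal,
    ρ (f (sInf {t | t ∈ Set.Icc a b ∧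
      ENNReal.ofReal u ≤ eVariationOn f (Set.Icc a t)}))

/-- The arclength integral `∫_γ ρ ds` of a density `ρ` along a path `γ`, defined as the
supremum of the arclength integrals over all compact subintervals of the parameter
interval. -/
def SpherePath.lineIntegral (γ : SpherePath) (ρ : ↥Sphere2 → ℝ≥0∞) : ℝ≥0∞ :=
  ⨆ (a : ℝ) (b : ℝ) (_ : Set.Icc a b ⊆ γ.I), arcIntegralOn ρ γ.toFun a b

/-- The conformal modulus `mod(Γ)` of a family of paths in `S²`: the infimum of
`∫ ρ² dσ` over all Borel densities `ρ : S² → [0,∞]` with `∫_γ ρ ds ≥ 1` for every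
locally rectifiable `γ ∈ Γ`. -/
def conformalModulus (Γ : Set SpherePath) : ℝ≥0∞ :=
  ⨅ (ρ : ↥Sphere2 → ℝ≥0∞) (_ : Measurable ρ)
    (_ : ∀ γ ∈ Γ, γ.LocRectifiable → 1 ≤ γ.lineIntegral ρ),
    ∫⁻ x, ρ x ^ 2 ∂sphereMeasure

/-- A carpet in `S²`: a subset homeomorphic to the standard Sierpiński carpet `S_3`. -/
def IsCarpet (S : Set ↥Sphere2) : Prop := Nonempty (↥S ≃ₜ ↥(sierpinskiCarpet 3))

/-- A peripheral circle of a carpet `S ⊆ S²`: a Jordan curve `C ⊆ S` (a subset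
homeomorphic to a circle) whose complement `S ∖ C` in `S` is connected. -/
def IsPeripheralCircle (S C : Set ↥Sphere2) : Prop :=
  C ⊆ S ∧ Nonempty (↥C ≃ₜ ↥(Metric.sphere (0 : ℂ) 1)) ∧ IsConnected (S \ C)

/-- `Σ_{C : γ ∩ C ≠ ∅} ρ(C)`: the total mass of the peripheral circles of `S` met by the
path `γ`. -/
def pathMassSum (S : Set ↥Sphere2) (ρ : Set ↥Sphere2 → ℝ≥0∞) (γ : SpherePath) : ℝ≥0∞ :=
  ∑' C : {C : Set ↥Sphere2 // IsPeripheralCircle S C ∧ (γ.image ∩ C).Nonempty}, ρ C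

/-- A mass distribution `ρ` on the peripheral circles of `S` is admissible for the carpet
modulus `mod_S(Γ)` if there is an exceptional family `Γ₀ ⊆ Γ` of conformal modulus zero
such that every `γ ∈ Γ ∖ Γ₀` meets peripheral circles of total mass at least `1`. -/
def CarpetAdmissible (S : Set ↥Sphere2) (Γ : Set SpherePath)
    (ρ : Set ↥Sphere2 → ℝ≥0∞) : Prop :=
  ∃ Γ₀ : Set SpherePath, Γ₀ ⊆ Γ ∧ conformalModulus Γ₀ = 0 ∧
    ∀ γ ∈ Γ \ Γ₀, 1 ≤ pathMassSum S ρ γ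

/-- The total mass `Σ_i ρ(C_i)²` of a mass distribution on the peripheral circles of a
carpet `S`. -/
def carpetMass (S : Set ↥Sphere2) (ρ : Set ↥Sphere2 → ℝ≥0∞) : ℝ≥0∞ :=
  ∑' C : {C : Set ↥Sphere2 // IsPeripheralCircle S C}, ρ C ^ 2

/-- The carpet modulus `mod_S(Γ)` of a path family `Γ` with respect to a carpet
`S ⊆ S²`. -/
def carpetModulus (S : Set ↥Sphere2) (Γ : Set SpherePath) : ℝ≥0∞ :=
  ⨅ (ρ : Set ↥Sphere2 → ℝ≥0∞) (_ : CarpetAdmissible S Γ ρ), carpetMass S ρ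

/-- A family of Jordan curves in `S²` consists of uniform quasicircles if there is a
single control function `η` such that each curve in the family is the image of the
Euclidean unit circle under an `η`-quasisymmetric map. -/
def UniformQuasicircles (𝒞 : Set (Set ↥Sphere2)) : Prop :=
  ∃ η : ℝ → ℝ, IsQSControl η ∧ ∀ C ∈ 𝒞,
    ∃ f : ↥(Metric.sphere (0 : ℂ) 1) → ↥Sphere2, Set.range f = C ∧
      Function.Injective f ∧
      ∀ u v w : ↥(Metric.sphere (0 : ℂ) 1), u ≠ w →
        dist (f u) (f v) ≤ η (dist u v / dist u w) * dist (f u) (f w)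

end

noncomputable section

/-- The distortion ratio `H_f(x,r)` of the metric definition of quasiconformality for a
map `f` defined on `D ⊆ S²`:
`sup{d(f x, f y) : y ∈ D, d(x,y) ≤ r} / inf{d(f x, f y) : y ∈ D, d(x,y) ≥ r}`. -/
def qcRatioOn (f : ↥Sphere2 → ↥Sphere2) (D : Set ↥Sphere2) (x : ↥Sphere2) (r : ℝ) :
    ℝ≥0∞ :=
  (⨆ y ∈ {y | y ∈ D ∧ dist x y ≤ r}, ENNReal.ofReal (dist (f x) (f y))) /
    ⨅ y ∈ {y | y ∈ D ∧ r ≤ dist x y}, ENNReal.ofReal (dist (f x) (f y))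

/-- `f` is a quasiconformal homeomorphism of the open region `D ⊆ S²` onto the open
region `D'` (metric definition): `f` restricts to a homeomorphism of `D` onto `D'` and
there is `H < ∞` with `limsup_{r→0} H_f(x,r) ≤ H` for every `x ∈ D`. -/
def IsQuasiconformalOn (f : ↥Sphere2 → ↥Sphere2) (D D' : Set ↥Sphere2) : Prop :=
  IsOpen D ∧ IsOpen D' ∧ Set.BijOn f D D' ∧ ContinuousOn f D ∧
    (∃ g : ↥Sphere2 → ↥Sphere2, ContinuousOn g D' ∧ ∀ x ∈ D, g (f x) = x) ∧
    ∃ H : ℝ≥0∞, H < ⊤ ∧ ∀ x ∈ D,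
      Filter.limsup (qcRatioOn f D x) (nhdsWithin 0 (Set.Ioi (0 : ℝ))) ≤ H

end

noncomputable section

/-- The image of a subset `C` of a carpet `S` under a self-homeomorphism `g` of `S`,
as a subset of `S²`. -/
def setImage (S : Set ↥Sphere2) (g : ↥S ≃ₜ ↥S) (C : Set ↥Sphere2) : Set ↥Sphere2 :=
  Subtype.val '' (g '' (Subtype.val ⁻¹' C))

/-- `G ⊆ Homeo(S)` is a group of homeomorphisms of `S`: it contains the identity and is
closed under composition and inversion. -/
def IsHomeoGroup (S : Set ↥Sphere2) (G : Set (↥S ≃ₜ ↥S)) : Prop :=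
  Homeomorph.refl ↥S ∈ G ∧ (∀ g ∈ G, ∀ h ∈ G, g.trans h ∈ G) ∧ ∀ g ∈ G, g.symm ∈ G

/-- The orbit of a peripheral circle `C` of `S` under the action of a group `G` of
homeomorphisms of `S`. -/
def periphOrbit (S : Set ↥Sphere2) (G : Set (↥S ≃ₜ ↥S)) (C : Set ↥Sphere2) :
    Set (Set ↥Sphere2) :=
  {C' | ∃ g ∈ G, C' = setImage S g C}

/-- The set of all orbits of peripheral circles of `S` under the action of `G`. -/
def periphOrbitSet (S : Set ↥Sphere2) (G : Set (↥S ≃ₜ ↥S)) : Set (Set (Set ↥Sphere2)) :=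
  {O | ∃ C : Set ↥Sphere2, IsPeripheralCircle S C ∧ O = periphOrbit S G C}

/-- A mass distribution `ρ` on the peripheral circles of `S` is invariant under `G` if it
takes the same value on each peripheral circle in the same orbit. -/
def InvariantMass (S : Set ↥Sphere2) (G : Set (↥S ≃ₜ ↥S))
    (ρ : Set ↥Sphere2 → ℝ≥0∞) : Prop :=
  ∀ g ∈ G, ∀ C : Set ↥Sphere2, IsPeripheralCircle S C → ρ (setImage S g C) = ρ C

/-- The total mass `mass_{S/G}(ρ) = Σ_𝒪 ρ(𝒪)²` of an invariant mass distribution, where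
the sum extends over all orbits `𝒪` of peripheral circles of `S` under `G` and `ρ(𝒪)`
is the common value of `ρ` on the circles in `𝒪`. -/
def groupMass (S : Set ↥Sphere2) (G : Set (↥S ≃ₜ ↥S)) (ρ : Set ↥Sphere2 → ℝ≥0∞) :
    ℝ≥0∞ :=
  ∑' O : ↥(periphOrbitSet S G), ⨆ C ∈ O.1, ρ C ^ 2

/-- The carpet modulus `mod_{S/G}(Γ)` of a path family `Γ` with respect to the action of
a group `G` of homeomorphisms of the carpet `S`: the infimum of `mass_{S/G}(ρ)` over all
invariant admissible mass distributions `ρ`. -/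
def groupCarpetModulus (S : Set ↥Sphere2) (G : Set (↥S ≃ₜ ↥S)) (Γ : Set SpherePath) :
    ℝ≥0∞ :=
  ⨅ (ρ : Set ↥Sphere2 → ℝ≥0∞) (_ : InvariantMass S G ρ)
    (_ : CarpetAdmissible S Γ ρ), groupMass S G ρ

end

noncomputable section

/-- The `n`-th iterate of a self-homeomorphism. -/
def homeoPow {X : Type*} [TopologicalSpace X] (e : X ≃ₜ X) : ℕ → (X ≃ₜ X)
  | 0 => Homeomorph.refl X
  | n + 1 => (homeoPow e n).trans e

/-- The `n`-th iterate of a self-homeomorphism, for `n ∈ ℤ`. -/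
def homeoZPow {X : Type*} [TopologicalSpace X] (e : X ≃ₜ X) : ℤ → (X ≃ₜ X)
  | Int.ofNat n => homeoPow e n
  | Int.negSucc n => (homeoPow e (n + 1)).symm

/-- The cyclic group `⟨e⟩ = {eⁿ : n ∈ ℤ}` of homeomorphisms generated by a
self-homeomorphism `e`. -/
def homeoCyclic {X : Type*} [TopologicalSpace X] (e : X ≃ₜ X) : Set (X ≃ₜ X) :=
  Set.range (homeoZPow e)

/-- The image path `Ψ ∘ γ` of a path `γ` in `S²` under a global self-homeomorphism `Ψ`
of `S²`. -/
def SpherePath.map (γ : SpherePath) (Ψ : ↥Sphere2 ≃ₜ ↥Sphere2) : SpherePath :=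
  ⟨γ.I, γ.hI, Ψ ∘ γ.toFun, Ψ.continuous.comp_continuousOn γ.cont⟩

end

section SphereRegularity

/-- Splitting of `ℝ³` into a line spanned by a unit vector and its orthogonal plane. -/
lemma exists_plane_projection (x : EuclideanSpace ℝ (Fin 3)) (hx : ‖x‖ = 1) :
    ∃ p : EuclideanSpace ℝ (Fin 3) →ₗ[ℝ] EuclideanSpace ℝ (Fin 2),
      (∀ y, ‖y‖ ^ 2 = ‖p y‖ ^ 2 + inner ℝ x y ^ 2) ∧
      ∀ v h, ∃ y, p y = v ∧ inner ℝ x y = h := by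
  have : Fact (Module.finrank ℝ (EuclideanSpace ℝ (Fin 3)) = 2 + 1) := ⟨by simp⟩
  have hx0 : x ≠ 0 := by
    rintro rfl
    simp at hx
  let e := (OrthonormalBasis.fromOrthogonalSpanSingleton (𝕜 := ℝ) 2 hx0).repr
  let q := (Submodule.span ℝ {x})ᗮ.orthogonalProjectionOnto
  refine ⟨e.toLinearEquiv.toLinearMap ∘ₗ q.toLinearMap, fun y => ?_, fun v h => ?_⟩
  · have h1 := Submodule.norm_sq_eq_add_norm_sq_projection y (Submodule.span ℝ {x})
    have h2 : ‖(Submodule.span ℝ {x}).orthogonalProjectionOnto y‖ ^ 2 = inner ℝ x y ^ 2 := by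
      rw [Submodule.coe_norm, ← Submodule.starProjection_apply,
        Submodule.starProjection_unit_singleton ℝ hx, norm_smul, hx]
      simp
    have h3 : ‖(e.toLinearEquiv.toLinearMap ∘ₗ q.toLinearMap) y‖ = ‖q y‖ :=
      e.norm_map (q y)
    rw [h3, h1, h2, add_comm]
  · refine ⟨(e.symm v : EuclideanSpace ℝ (Fin 3)) + h • x, ?_, ?_⟩
    · have h4 : q ((e.symm v : EuclideanSpace ℝ (Fin 3)) + h • x) = e.symm v := by
        rw [map_add, Submodule.orthogonalProjectionOnto_mem_subspace_eq_self,
          Submodule.orthogonalProjectionOnto_eq_zero_iff.mpr, add_zero]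
        intro w hw
        rw [Submodule.mem_orthogonal_singleton_iff_inner_left] at hw
        rw [inner_smul_right, hw, mul_zero]
      change e (q _) = v
      rw [h4]
      simp
    · have h5 := (Submodule.mem_orthogonal_singleton_iff_inner_right).1 (e.symm v).2
      rw [inner_add_right, h5, inner_smul_right, real_inner_self_eq_norm_sq, hx]
      simp

lemma norm_sphere2 (x : ↥Sphere2) : ‖(x : EuclideanSpace ℝ (Fin 3))‖ = 1 := by
  have := x.2
  unfold Sphere2 at this
  simpa using this

lemma dist_sphere2_le (x y : ↥Sphere2) : dist x y ≤ 2 := by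
  rw [Subtype.dist_eq]
  calc dist (x : EuclideanSpace ℝ (Fin 3)) y ≤
      ‖(x : EuclideanSpace ℝ (Fin 3))‖ + ‖(y : EuclideanSpace ℝ (Fin 3))‖ := by
        rw [dist_eq_norm]
        exact norm_sub_le _ _
    _ = 2 := by
        rw [norm_sphere2, norm_sphere2]
        norm_num

instance compactSpace_sphere2 : CompactSpace ↥Sphere2 :=
  isCompact_iff_compactSpace.1 (isCompact_sphere _ _)

lemma dist_sq_sphere2 (x y : ↥Sphere2) :
    dist x y ^ 2 = 2 - 2 * inner ℝ (x : EuclideanSpace ℝ (Fin 3)) y := by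
  rw [Subtype.dist_eq, dist_eq_norm, @norm_sub_sq_real, norm_sphere2, norm_sphere2]
  ring

lemma hausdorffMeasure_plane_ball (r : ℝ) (hr : 0 ≤ r) :
    (μH[2] : Measure (EuclideanSpace ℝ (Fin 2))) (ball 0 r) =
      ENNReal.ofReal r ^ 2 * (μH[2] : Measure (EuclideanSpace ℝ (Fin 2))) (ball 0 1) := by
  have h : ((Module.finrank ℝ (EuclideanSpace ℝ (Fin 2)) : ℕ) : ℝ) = 2 := by simp
  have hi : (μH[2] : Measure (EuclideanSpace ℝ (Fin 2))).IsAddHaarMeasure := by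
    rw [← h]
    infer_instance
  rw [Measure.addHaar_ball _ _ hr, ENNReal.ofReal_pow hr]
  simp

lemma hausdorffMeasure_plane_unit_ball :
    (μH[2] : Measure (EuclideanSpace ℝ (Fin 2))) (ball 0 1) ≠ 0 ∧
      (μH[2] : Measure (EuclideanSpace ℝ (Fin 2))) (ball 0 1) ≠ ⊤ := by
  have h : ((Module.finrank ℝ (EuclideanSpace ℝ (Fin 2)) : ℕ) : ℝ) = 2 := by simp
  have hi : (μH[2] : Measure (EuclideanSpace ℝ (Fin 2))).IsAddHaarMeasure := by
    rw [← h]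
    infer_instance
  exact ⟨(measure_ball_pos _ _ one_pos).ne', measure_ball_lt_top.ne⟩

lemma sphereMeasure_ball_ge :
    ∃ c : ℝ≥0∞, c ≠ 0 ∧ c ≠ ⊤ ∧ ∀ (x : ↥Sphere2) (r : ℝ), 0 < r → r ≤ 2 →
      c * ENNReal.ofReal r ^ 2 ≤ sphereMeasure (ball x r) := by
  obtain ⟨h0, ht⟩ := hausdorffMeasure_plane_unit_ball
  refine ⟨ENNReal.ofReal (1 / 2) ^ 2 * (μH[2] : Measure (EuclideanSpace ℝ (Fin 2))) (ball 0 1),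
    mul_ne_zero (by simp) h0, ENNReal.mul_ne_top (by simp) ht, fun x r hr hr2 => ?_⟩
  obtain ⟨p, hp, hsurj⟩ := exists_plane_projection x (norm_sphere2 x)
  have hlip : LipschitzWith 1 (fun y : ↥Sphere2 => p y) := by
    refine LipschitzWith.of_dist_le_mul fun y z => ?_
    rw [NNReal.coe_one, one_mul, Subtype.dist_eq, dist_eq_norm, dist_eq_norm, ← map_sub]
    refine abs_le_of_sq_le_sq' ?_ (norm_nonneg _) |>.2
    rw [hp ((y : EuclideanSpace ℝ (Fin 3)) - z)]
    nlinarith [sq_nonneg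
      (inner ℝ (x : EuclideanSpace ℝ (Fin 3)) (y - z : EuclideanSpace ℝ (Fin 3)))]
  have hsub : ball (0 : EuclideanSpace ℝ (Fin 2)) (r / 2) ⊆
      (fun y : ↥Sphere2 => p y) '' ball x r := by
    intro v hv
    rw [mem_ball_zero_iff] at hv
    have hv0 := norm_nonneg v
    have hv1 : ‖v‖ ^ 2 ≤ 1 := by nlinarith
    obtain ⟨y, hy, hxy⟩ := hsurj v (√(1 - ‖v‖ ^ 2))
    have hsq : √(1 - ‖v‖ ^ 2) ^ 2 = 1 - ‖v‖ ^ 2 := Real.sq_sqrt (by linarith)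
    have hsq0 : 0 ≤ √(1 - ‖v‖ ^ 2) := Real.sqrt_nonneg _
    have hsq1 : √(1 - ‖v‖ ^ 2) ≤ 1 := by nlinarith [sq_nonneg ‖v‖]
    have hyn : ‖y‖ = 1 := by
      have := hp y
      rw [hy, hxy, hsq] at this
      have h0 := norm_nonneg y
      nlinarith
    refine ⟨⟨y, by simp [Sphere2, hyn]⟩, ?_, hy⟩
    rw [mem_ball]
    have hd := dist_sq_sphere2 ⟨y, by simp [Sphere2, hyn]⟩ x
    rw [real_inner_comm, hxy] at hd
    refine lt_of_pow_lt_pow_left₀ 2 hr.le ?_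
    rw [hd]
    nlinarith
  calc _ = (μH[2] : Measure (EuclideanSpace ℝ (Fin 2))) (ball 0 (r / 2)) := by
        rw [hausdorffMeasure_plane_ball (r / 2) (by positivity),
          show r / 2 = 1 / 2 * r by ring, ENNReal.ofReal_mul (by norm_num)]
        ring
    _ ≤ μH[2] ((fun y : ↥Sphere2 => p y) '' ball x r) := measure_mono hsub
    _ ≤ _ := by
        have := hlip.hausdorffMeasure_image_le (d := 2) (by norm_num) (ball x r)
        simpa [sphereMeasure] using this

lemma sphereMeasure_ball_le :
    ∃ C : ℝ≥0∞, C ≠ ⊤ ∧ ∀ (x : ↥Sphere2) (r : ℝ), 0 < r → r ≤ 1 →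
      sphereMeasure (ball x r) ≤ C * ENNReal.ofReal r ^ 2 := by
  obtain ⟨h0, ht⟩ := hausdorffMeasure_plane_unit_ball
  refine ⟨3 ^ 2 * (μH[2] : Measure (EuclideanSpace ℝ (Fin 2))) (ball 0 1),
    ENNReal.mul_ne_top (by simp) ht, fun x r hr hr1 => ?_⟩
  obtain ⟨p, hp, -⟩ := exists_plane_projection x (norm_sphere2 x)
  have hheight : ∀ y : ↥Sphere2, y ∈ ball x r →
      1 / 2 ≤ inner ℝ (x : EuclideanSpace ℝ (Fin 3)) y := by
    intro y hy
    rw [mem_ball'] at hy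
    have := dist_sq_sphere2 x y
    nlinarith [dist_nonneg (x := x) (y := y)]
  have hanti : AntilipschitzWith 3 (fun y : ↥(ball x r) => p y) := by
    refine AntilipschitzWith.of_le_mul_dist fun y z => ?_
    have hy := hheight _ y.2
    have hz := hheight _ z.2
    have hyp := hp (y : ↥Sphere2)
    have hzp := hp (z : ↥Sphere2)
    have hyz := hp ((y : ↥Sphere2) - (z : ↥Sphere2) : EuclideanSpace ℝ (Fin 3))
    rw [norm_sphere2] at hyp hzp
    rw [inner_sub_right, map_sub] at hyz
    rw [Subtype.dist_eq, Subtype.dist_eq, dist_eq_norm, dist_eq_norm]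
    set a := inner ℝ (x : EuclideanSpace ℝ (Fin 3)) (y : ↥Sphere2)
    set b := inner ℝ (x : EuclideanSpace ℝ (Fin 3)) (z : ↥Sphere2)
    have hyn : ‖p (y : ↥Sphere2)‖ ≤ 1 := by nlinarith [norm_nonneg (p (y : ↥Sphere2))]
    have hzn : ‖p (z : ↥Sphere2)‖ ≤ 1 := by nlinarith [norm_nonneg (p (z : ↥Sphere2))]
    have hn1 := norm_sub_norm_le (p (y : ↥Sphere2)) (p (z : ↥Sphere2))
    have hn2 := norm_sub_norm_le (p (z : ↥Sphere2)) (p (y : ↥Sphere2))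
    rw [norm_sub_rev] at hn2
    set t := ‖p (y : ↥Sphere2) - p (z : ↥Sphere2)‖
    have ht0 : 0 ≤ t := norm_nonneg _
    have hyn0 := norm_nonneg (p (y : ↥Sphere2))
    have hzn0 := norm_nonneg (p (z : ↥Sphere2))
    set Y := ‖p (y : ↥Sphere2)‖
    set Z := ‖p (z : ↥Sphere2)‖
    have hab : |a - b| ≤ 2 * t := by
      have h1 : |a - b| * 1 ≤ |a - b| * (a + b) :=
        mul_le_mul_of_nonneg_left (by linarith) (abs_nonneg _)
      have h2 : |a - b| * (a + b) = |Z - Y| * (Z + Y) := by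
        rw [← abs_of_nonneg (show 0 ≤ a + b by linarith), ← abs_mul,
          ← abs_of_nonneg (show 0 ≤ Z + Y by linarith), ← abs_mul]
        congr 1
        nlinarith
      have h3 : |Z - Y| ≤ t := abs_le.2 ⟨by linarith, by linarith⟩
      nlinarith [abs_nonneg (Z - Y)]
    have hab2 : (a - b) ^ 2 ≤ (2 * t) ^ 2 := by
      rw [← sq_abs]
      exact pow_le_pow_left₀ (abs_nonneg _) hab 2
    refine abs_le_of_sq_le_sq' ?_ (by positivity) |>.2
    rw [hyz]
    push_cast
    nlinarith
  have hsub : (fun y : ↥(ball x r) => p y) '' univ ⊆ ball 0 r := by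
    rintro _ ⟨y, -, rfl⟩
    rw [mem_ball_zero_iff]
    have hy := y.2
    rw [mem_ball, Subtype.dist_eq, dist_eq_norm] at hy
    have h1 := hp ((y : ↥Sphere2) - x : EuclideanSpace ℝ (Fin 3))
    have h2 := hp (x : EuclideanSpace ℝ (Fin 3))
    rw [norm_sphere2, real_inner_self_eq_norm_sq, norm_sphere2] at h2
    have h3 : ‖p x‖ = 0 := by
      have : ‖p x‖ ^ 2 = 0 := by linarith
      exact pow_eq_zero_iff (two_ne_zero) |>.1 this
    rw [map_sub, norm_eq_zero.1 h3, sub_zero] at h1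
    refine lt_of_le_of_lt (abs_le_of_sq_le_sq' ?_ (norm_nonneg _) |>.2) hy
    nlinarith [sq_nonneg
      (inner ℝ (x : EuclideanSpace ℝ (Fin 3)) ((y : ↥Sphere2) - x : EuclideanSpace ℝ (Fin 3)))]
  have h1 : sphereMeasure (ball x r) = μH[2] (univ : Set ↥(ball x r)) := by
    have := (isometry_subtype_coe (s := ball x r)).hausdorffMeasure_image (d := 2)
      (Or.inl (by norm_num)) univ
    rw [← this, image_univ, Subtype.range_coe]
    rfl
  rw [h1]
  calc _ ≤ ((3 : NNReal) : ℝ≥0∞) ^ (2 : ℝ) * μH[2] ((fun y : ↥(ball x r) => p y) '' univ) :=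
        hanti.le_hausdorffMeasure_image (by norm_num) univ
    _ ≤ ((3 : NNReal) : ℝ≥0∞) ^ (2 : ℝ) *
        (μH[2] : Measure (EuclideanSpace ℝ (Fin 2))) (ball 0 r) := by gcongr
    _ = _ := by
        rw [hausdorffMeasure_plane_ball _ hr.le]
        norm_num
        ring

instance isFiniteMeasure_sphereMeasure : IsFiniteMeasure sphereMeasure := by
  obtain ⟨C, hC, h⟩ := sphereMeasure_ball_le
  refine ⟨isCompact_univ.measure_lt_top_of_nhdsWithin fun x _ => ?_⟩
  refine ⟨ball x 1, mem_nhdsWithin_of_mem_nhds (ball_mem_nhds x one_pos), ?_⟩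
  exact (h x 1 one_pos le_rfl).trans_lt (ENNReal.mul_lt_top hC.lt_top (by simp))

end SphereRegularity

section ConvexCombinations

lemma eLpNorm_two_sq {X : Type*} [MeasurableSpace X] {E : Type*} [TopologicalSpace E]
    [ContinuousENorm E] (μ : Measure X) (u : X → E) :
    eLpNorm u 2 μ ^ 2 = ∫⁻ x, ‖u x‖ₑ ^ 2 ∂μ := by
  have := eLpNorm_nnreal_pow_eq_lintegral (μ := μ) (f := u) (p := 2) two_ne_zero
  simpa using this

/-- A series of functions with geometrically decaying `L²` norms is in `L²`. -/
lemma lintegral_sq_tsum_lt_top {X : Type*} [MeasurableSpace X] (μ : Measure X)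
    (u : ℕ → X → ℝ≥0∞) (hu : ∀ n, Measurable (u n))
    (h : ∀ n, eLpNorm (u n) 2 μ ≤ 2⁻¹ ^ n) :
    ∫⁻ x, (∑' n, u n x) ^ 2 ∂μ < ⊤ := by
  have hmono : Monotone fun (n : ℕ) (x : X) => (∑ i ∈ Finset.range n, u i x) ^ 2 := by
    intro m n hmn x
    have : ∑ i ∈ Finset.range m, u i x ≤ ∑ i ∈ Finset.range n, u i x :=
      Finset.sum_le_sum_of_subset (Finset.range_subset_range.2 hmn)
    exact pow_le_pow_left' this 2
  have hsup : ∀ x, (∑' n, u n x) ^ 2 = ⨆ n, (∑ i ∈ Finset.range n, u i x) ^ 2 := by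
    intro x
    refine tendsto_nhds_unique ?_ (tendsto_atTop_iSup fun m n hmn => hmono hmn x)
    exact ((ENNReal.continuous_pow 2).tendsto _).comp
      (ENNReal.summable.hasSum (f := fun n => u n x)).tendsto_sum_nat
  simp_rw [hsup]
  rw [lintegral_iSup (fun n => (Finset.measurable_sum _ fun i _ => hu i).pow_const 2) hmono]
  refine lt_of_le_of_lt (iSup_le fun n => ?_) (show (2 : ℝ≥0∞) ^ 2 < ⊤ by simp)
  have h1 := eLpNorm_two_sq μ (∑ i ∈ Finset.range n, u i)
  have h2 : eLpNorm (∑ i ∈ Finset.range n, u i) 2 μ ≤ 2 := by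
    refine (eLpNorm_sum_le (fun i _ => (hu i).aestronglyMeasurable) (by norm_num)).trans ?_
    calc ∑ i ∈ Finset.range n, eLpNorm (u i) 2 μ ≤ ∑ i ∈ Finset.range n, 2⁻¹ ^ i :=
          Finset.sum_le_sum fun i _ => h i
      _ ≤ ∑' i : ℕ, (2⁻¹ : ℝ≥0∞) ^ i := ENNReal.sum_le_tsum _
      _ = 2 := by
          rw [ENNReal.tsum_geometric]
          simp
  simp only [Finset.sum_apply, enorm_eq_self] at h1
  rw [← h1]
  gcongr

lemma lintegral_sq_add_lt_top {X : Type*} [MeasurableSpace X] {μ : Measure X}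
    {u v : X → ℝ≥0∞} (hu : Measurable u) (hut : ∫⁻ x, u x ^ 2 ∂μ < ⊤)
    (hvt : ∫⁻ x, v x ^ 2 ∂μ < ⊤) : ∫⁻ x, (u x + v x) ^ 2 ∂μ < ⊤ := by
  calc ∫⁻ x, (u x + v x) ^ 2 ∂μ ≤ ∫⁻ x, (2 * u x ^ 2 + 2 * v x ^ 2) ∂μ := by
        refine lintegral_mono fun x => ?_
        rcases eq_or_ne (u x) ⊤ with h | h
        · simp [h]
        rcases eq_or_ne (v x) ⊤ with h' | h'
        · simp [h']
        lift u x to NNReal using h with p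
        lift v x to NNReal using h' with q
        rw [← mul_add]
        exact_mod_cast add_sq_le (a := p) (b := q)
    _ = 2 * ∫⁻ x, u x ^ 2 ∂μ + 2 * ∫⁻ x, v x ^ 2 ∂μ := by
        rw [lintegral_add_left ((hu.pow_const 2).const_mul 2), lintegral_const_mul' _ _ (by simp),
          lintegral_const_mul' _ _ (by simp)]
    _ < ⊤ := ENNReal.add_lt_top.2
        ⟨ENNReal.mul_lt_top (by simp) hut, ENNReal.mul_lt_top (by simp) hvt⟩

/-- Finitely supported convex weights on the indices `≥ N`. -/
def tailWeights (N : ℕ) : Set (ℕ →₀ ℝ) :=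
  {w | (∀ j, 0 ≤ w j) ∧ (∀ j < N, w j = 0) ∧ Finsupp.linearCombination ℝ (fun _ => (1 : ℝ)) w = 1}

lemma tailWeights_anti {M N : ℕ} (h : M ≤ N) : tailWeights N ⊆ tailWeights M :=
  fun _ hw => ⟨hw.1, fun j hj => hw.2.1 j (hj.trans_le h), hw.2.2⟩

lemma single_mem_tailWeights (N : ℕ) : Finsupp.single N (1 : ℝ) ∈ tailWeights N := by
  refine ⟨fun j => ?_, fun j hj => Finsupp.single_eq_of_ne hj.ne, by simp⟩
  rw [Finsupp.single_apply]
  split_ifs <;> norm_num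

lemma midpoint_mem_tailWeights {N : ℕ} {w w' : ℕ →₀ ℝ} (h : w ∈ tailWeights N)
    (h' : w' ∈ tailWeights N) : (1 / 2 : ℝ) • (w + w') ∈ tailWeights N := by
  refine ⟨fun j => ?_, fun j hj => ?_, ?_⟩
  · have := h.1 j
    have := h'.1 j
    simp only [Finsupp.smul_apply, Finsupp.add_apply, smul_eq_mul]
    positivity
  · simp [h.2.1 j hj, h'.2.1 j hj]
  · rw [map_smul, map_add, h.2.2, h'.2.2]
    norm_num

/-- In an inner product space, a bounded sequence admits convex combinations of its tails that
form a rapidly Cauchy sequence. -/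
lemma exists_tailWeights_dist_le {E : Type*} [NormedAddCommGroup E] [InnerProductSpace ℝ E]
    (v : ℕ → E) (B : ℝ) (hv : ∀ n, ‖v n‖ ≤ B) :
    ∃ w : ℕ → ℕ →₀ ℝ, (∀ n, w n ∈ tailWeights n) ∧
      ∀ n, dist (Finsupp.linearCombination ℝ v (w (n + 1)))
        (Finsupp.linearCombination ℝ v (w n)) < (1 / 2) ^ n := by
  set T := Finsupp.linearCombination ℝ v
  let A : ℕ → Set ℝ := fun N => (fun w => ‖T w‖ ^ 2) '' tailWeights N
  let d : ℕ → ℝ := fun N => sInf (A N)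
  have hbdd : ∀ N, BddBelow (A N) := fun N => ⟨0, by rintro _ ⟨w, -, rfl⟩; positivity⟩
  have hne : ∀ N, (A N).Nonempty := fun N => ⟨_, _, single_mem_tailWeights N, rfl⟩
  have hdmono : Monotone d := fun M N h =>
    csInf_le_csInf (hbdd M) (hne N) (image_mono (tailWeights_anti h))
  have hdB : ∀ N, d N ≤ B ^ 2 := by
    intro N
    refine (csInf_le (hbdd N) ⟨_, single_mem_tailWeights N, rfl⟩).trans ?_
    simp only [T, Finsupp.linearCombination_single, one_smul]
    exact pow_le_pow_left₀ (norm_nonneg _) (hv N) 2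
  have hdb : BddAbove (range d) := ⟨B ^ 2, by rintro _ ⟨N, rfl⟩; exact hdB N⟩
  have hex : ∀ N : ℕ, ∃ w ∈ tailWeights N, ‖T w‖ ^ 2 < d N + 1 / ((N : ℝ) + 1) := by
    intro N
    obtain ⟨_, ⟨w, hw, rfl⟩, hlt⟩ := exists_lt_of_csInf_lt (hne N)
      (show d N < d N + 1 / ((N : ℝ) + 1) by
        have : 0 < 1 / ((N : ℝ) + 1) := by positivity
        linarith)
    exact ⟨w, hw, hlt⟩
  choose w hw hwlt using hex
  have hcauchy : CauchySeq fun N => T (w N) := by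
    refine cauchySeq_of_le_tendsto_0' (fun N => √(2 * ((⨆ n, d n) - d N) + 4 * (1 / ((N : ℝ) + 1))))
      (fun N M hNM => ?_) ?_
    · refine Real.le_sqrt_of_sq_le ?_
      rw [dist_eq_norm]
      have hpar := parallelogram_law_with_norm ℝ (T (w N)) (T (w M))
      have hmid : d N ≤ ‖T ((1 / 2 : ℝ) • (w N + w M))‖ ^ 2 :=
        csInf_le (hbdd N) ⟨_, midpoint_mem_tailWeights (hw N) (tailWeights_anti hNM (hw M)), rfl⟩
      rw [map_smul, map_add, norm_smul, mul_pow] at hmid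
      norm_num at hmid
      have h1 := hwlt N
      have h2 := hwlt M
      have h3 : d M ≤ ⨆ n, d n := le_ciSup hdb M
      have h4 : 1 / ((M : ℝ) + 1) ≤ 1 / ((N : ℝ) + 1) := by
        have : (N : ℝ) ≤ M := by exact_mod_cast hNM
        gcongr
      nlinarith
    · have h1 : Tendsto d atTop (𝓝 (⨆ n, d n)) := tendsto_atTop_ciSup hdmono hdb
      have h2 := ((tendsto_const_nhds (x := ⨆ n, d n)).sub h1).const_mul 2
      have h3 := (tendsto_one_div_add_atTop_nhds_zero_nat (𝕜 := ℝ)).const_mul 4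
      have h4 := (Real.continuous_sqrt.tendsto _).comp (h2.add h3)
      simpa [Function.comp_def] using h4
  obtain ⟨φ, hφ, hdist⟩ := hcauchy.subseq_mem (V := fun n => {p | dist p.1 p.2 < (1 / 2) ^ n})
    fun n => dist_mem_uniformity (by positivity)
  exact ⟨fun n => w (φ n), fun n => tailWeights_anti hφ.le_apply (hw _), hdist⟩

/-- For an `L²`-bounded sequence of functions there is a single `L²` function dominating,
everywhere, convex combinations of arbitrarily late terms. -/
lemma exists_lintegral_sq_dominating {X : Type*} [MeasurableSpace X] (μ : Measure X)
    (g : ℕ → X → NNReal) (hg : ∀ n, Measurable (g n)) (M : ℝ≥0∞) (hM : M ≠ ⊤)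
    (hgM : ∀ n, ∫⁻ x, (g n x : ℝ≥0∞) ^ 2 ∂μ ≤ M) :
    ∃ G : X → ℝ≥0∞, Measurable G ∧ ∫⁻ x, G x ^ 2 ∂μ < ⊤ ∧
      ∀ N : ℕ, ∃ (s : Finset ℕ) (w : ℕ → NNReal), (∀ j ∈ s, N ≤ j) ∧ ∑ j ∈ s, w j = 1 ∧
        ∀ x, ∑ j ∈ s, (w j : ℝ≥0∞) * g j x ≤ G x := by
  have hsq : ∀ n, eLpNorm (fun x => (g n x : ℝ)) 2 μ ^ 2 ≤ M := by
    intro n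
    rw [eLpNorm_two_sq]
    simpa using hgM n
  have hlp : ∀ n, MemLp (fun x => (g n x : ℝ)) 2 μ := by
    refine fun n => ⟨(hg n).coe_nnreal_real.aestronglyMeasurable, ?_⟩
    by_contra h
    rw [not_lt_top_iff] at h
    have := hsq n
    rw [h] at this
    simp at this
    exact hM this
  let v : ℕ → Lp ℝ 2 μ := fun n => (hlp n).toLp
  have hv : ∀ n, ‖v n‖ ≤ √M.toReal := by
    intro n
    refine Real.le_sqrt_of_sq_le ?_
    rw [Lp.norm_toLp, ← ENNReal.toReal_pow]
    exact ENNReal.toReal_mono hM (hsq n)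
  obtain ⟨w, hw, hdist⟩ := exists_tailWeights_dist_le v _ hv
  let h : ℕ → X → ℝ := fun n x => ∑ j ∈ (w n).support, w n j * g j x
  have hmeas : ∀ n, Measurable (h n) := fun n =>
    Finset.measurable_sum _ fun j _ => ((hg j).coe_nnreal_real).const_mul _
  have hT : ∀ n, (Finsupp.linearCombination ℝ v (w n) : Lp ℝ 2 μ) =ᵐ[μ] h n := by
    intro n
    have h1 : ∀ᵐ x ∂μ, ∀ j, v j x = g j x := ae_all_iff.2 fun j => (hlp j).coeFn_toLp
    have h2 : ∀ s : Finset ℕ, ((∑ j ∈ s, w n j • v j : Lp ℝ 2 μ) : X → ℝ) =ᵐ[μ]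
        fun x => ∑ j ∈ s, w n j * v j x := by
      intro s
      induction s using Finset.induction_on with
      | empty =>
        simp only [Finset.sum_empty]
        exact Lp.coeFn_zero _ _ _
      | insert a s ha ih =>
        rw [Finset.sum_insert ha]
        filter_upwards [Lp.coeFn_add (w n a • v a) (∑ j ∈ s, w n j • v j), ih,
          Lp.coeFn_smul (w n a) (v a)] with x hx1 hx2 hx3
        rw [hx1, Pi.add_apply, hx2, hx3, Finset.sum_insert ha]
        rfl
    filter_upwards [h1, h2 (w n).support] with x hx1 hx2
    rw [Finsupp.linearCombination_apply, Finsupp.sum, hx2]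
    simp only [h, hx1]
  let u : ℕ → X → ℝ≥0∞ := fun n x => ‖h (n + 1) x - h n x‖ₑ
  have hu : ∀ n, Measurable (u n) := fun n => ((hmeas (n + 1)).sub (hmeas n)).enorm
  have hun : ∀ n, eLpNorm (u n) 2 μ ≤ 2⁻¹ ^ n := by
    intro n
    have h1 : eLpNorm (u n) 2 μ = eLpNorm (h (n + 1) - h n) 2 μ :=
      eLpNorm_congr_enorm_ae (Eventually.of_forall fun x => by simp [u])
    have h2 : eLpNorm (h (n + 1) - h n) 2 μ =
        eLpNorm ((Finsupp.linearCombination ℝ v (w (n + 1)) : Lp ℝ 2 μ) -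
          (Finsupp.linearCombination ℝ v (w n) : Lp ℝ 2 μ) : X → ℝ) 2 μ :=
      eLpNorm_congr_ae ((hT (n + 1)).symm.sub (hT n).symm)
    rw [h1, h2, ← Lp.edist_def, edist_dist]
    refine (ENNReal.ofReal_le_ofReal (hdist n).le).trans_eq ?_
    rw [ENNReal.ofReal_pow (by norm_num), one_div, ENNReal.ofReal_inv_of_pos two_pos]
    simp
  have hh0 : ∀ n x, 0 ≤ h n x := fun n x =>
    Finset.sum_nonneg fun j _ => mul_nonneg ((hw n).1 j) (g j x).2
  have hh0t : ∫⁻ x, ENNReal.ofReal (h 0 x) ^ 2 ∂μ < ⊤ := by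
    have h1 : MemLp (h 0) 2 μ := memLp_finsetSum _ fun j _ => (hlp j).const_mul _
    have h2 := eLpNorm_two_sq μ (h 0)
    have h3 : ∀ x, ENNReal.ofReal (h 0 x) = ‖h 0 x‖ₑ := fun x =>
      (Real.enorm_eq_ofReal (hh0 0 x)).symm
    simp_rw [h3, ← h2]
    exact ENNReal.pow_lt_top h1.2
  refine ⟨fun x => ENNReal.ofReal (h 0 x) + ∑' n, u n x,
    (hmeas 0).ennreal_ofReal.add (Measurable.tsum hu),
    lintegral_sq_add_lt_top (hmeas 0).ennreal_ofReal hh0t (lintegral_sq_tsum_lt_top μ u hu hun),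
    fun N => ⟨(w N).support, fun j => (w N j).toNNReal, fun j hj => ?_, ?_, fun x => ?_⟩⟩
  · by_contra hlt
    exact Finsupp.mem_support_iff.1 hj ((hw N).2.1 j (not_le.1 hlt))
  · have h1 := (hw N).2.2
    rw [Finsupp.linearCombination_apply, Finsupp.sum] at h1
    rw [← NNReal.coe_inj]
    push_cast
    rw [← h1]
    refine Finset.sum_congr rfl fun j _ => ?_
    rw [Real.coe_toNNReal _ ((hw N).1 j)]
    simp
  · have h1 : ∀ n, ENNReal.ofReal (h n x) ≤
        ENNReal.ofReal (h 0 x) + ∑ i ∈ Finset.range n, u i x := by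
      intro n
      induction n with
      | zero => simp
      | succ n ih =>
        rw [Finset.sum_range_succ, ← add_assoc]
        refine le_trans ?_ (add_le_add_left ih _)
        have h2 : u n x = ENNReal.ofReal |h (n + 1) x - h n x| := Real.enorm_eq_ofReal_abs _
        rw [h2, ← ENNReal.ofReal_add (hh0 n x) (abs_nonneg _)]
        refine ENNReal.ofReal_le_ofReal ?_
        linarith [le_abs_self (h (n + 1) x - h n x)]
    refine le_trans (le_of_eq ?_) ((h1 N).trans (add_le_add_right (ENNReal.sum_le_tsum _) _))
    change _ = ENNReal.ofReal (∑ j ∈ (w N).support, w N j * g j x)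
    rw [ENNReal.ofReal_sum_of_nonneg fun j _ => mul_nonneg ((hw N).1 j) (g j x).coe_nonneg]
    refine Finset.sum_congr rfl fun j _ => ?_
    rw [ENNReal.ofReal_mul ((hw N).1 j), ENNReal.ofReal_coe_nnreal]
    rfl

end ConvexCombinations

section ArcLength

variable {E : Type*} [PseudoMetricSpace E]

/-- The length of `f` on `[a, b]`, as a real number. -/
noncomputable def arcLen (f : ℝ → E) (a b : ℝ) : ℝ := (eVariationOn f (Icc a b)).toReal

/-- The first time at which `f` has run through arclength `u`, counted from `a`. -/
noncomputable def arcTime (f : ℝ → E) (a b u : ℝ) : ℝ :=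
  sInf {t | t ∈ Icc a b ∧ ENNReal.ofReal u ≤ eVariationOn f (Icc a t)}

lemma eVariationOn_Icc_ne_top {f : ℝ → E} {a b s t : ℝ}
    (h : eVariationOn f (Icc a b) ≠ ⊤) (has : a ≤ s) (htb : t ≤ b) :
    eVariationOn f (Icc s t) ≠ ⊤ :=
  ne_top_of_le_ne_top h (eVariationOn.mono f (Icc_subset_Icc has htb))

lemma arcLen_nonneg (f : ℝ → E) (a b : ℝ) : 0 ≤ arcLen f a b := ENNReal.toReal_nonneg

lemma eVariationOn_Icc_add {f : ℝ → E} {s t r : ℝ} (hst : s ≤ t) (htr : t ≤ r) :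
    eVariationOn f (Icc s t) + eVariationOn f (Icc t r) = eVariationOn f (Icc s r) := by
  simpa using eVariationOn.Icc_add_Icc f (s := univ) hst htr (mem_univ t)

lemma arcLen_add {f : ℝ → E} {s t r : ℝ} (h : eVariationOn f (Icc s r) ≠ ⊤) (hst : s ≤ t)
    (htr : t ≤ r) : arcLen f s t + arcLen f t r = arcLen f s r := by
  rw [arcLen, arcLen, arcLen, ← ENNReal.toReal_add (eVariationOn_Icc_ne_top h le_rfl htr)
    (eVariationOn_Icc_ne_top h hst le_rfl), eVariationOn_Icc_add hst htr]

lemma dist_le_arcLen {f : ℝ → E} {s t : ℝ} (h : eVariationOn f (Icc s t) ≠ ⊤) (hst : s ≤ t) :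
    dist (f s) (f t) ≤ arcLen f s t := by
  rw [dist_edist]
  exact ENNReal.toReal_mono h
    (eVariationOn.edist_le f (left_mem_Icc.2 hst) (right_mem_Icc.2 hst))

lemma arcLen_self (f : ℝ → E) (a : ℝ) : arcLen f a a = 0 := by
  simp [arcLen, eVariationOn.subsingleton]

lemma ofReal_le_eVariationOn_iff {f : ℝ → E} {a b t u : ℝ}
    (h : eVariationOn f (Icc a b) ≠ ⊤) (ht : t ∈ Icc a b) :
    ENNReal.ofReal u ≤ eVariationOn f (Icc a t) ↔ u ≤ arcLen f a t :=
  ENNReal.ofReal_le_iff_le_toReal (eVariationOn_Icc_ne_top h le_rfl ht.2)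

lemma arcTime_mem {f : ℝ → E} {a b u : ℝ} (h : eVariationOn f (Icc a b) ≠ ⊤)
    (hab : a ≤ b) (hu : u ≤ arcLen f a b) : arcTime f a b u ∈ Icc a b :=
  ⟨le_csInf ⟨b, right_mem_Icc.2 hab,
      (ofReal_le_eVariationOn_iff h (right_mem_Icc.2 hab)).2 hu⟩ fun _ ht => ht.1.1,
    csInf_le ⟨a, fun _ ht => ht.1.1⟩ ⟨right_mem_Icc.2 hab,
      (ofReal_le_eVariationOn_iff h (right_mem_Icc.2 hab)).2 hu⟩⟩

lemma le_arcLen_of_arcTime_lt {f : ℝ → E} {a b u : ℝ} (h : eVariationOn f (Icc a b) ≠ ⊤)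
    (hab : a ≤ b) (hu : u ≤ arcLen f a b) {t : ℝ} (ht : t ∈ Icc a b) (hlt : arcTime f a b u < t) :
    u ≤ arcLen f a t := by
  obtain ⟨s, hs, hst⟩ := exists_lt_of_csInf_lt (s :=
    {t | t ∈ Icc a b ∧ ENNReal.ofReal u ≤ eVariationOn f (Icc a t)}) ⟨b, right_mem_Icc.2 hab,
      (ofReal_le_eVariationOn_iff h (right_mem_Icc.2 hab)).2 hu⟩ hlt
  have h1 := (ofReal_le_eVariationOn_iff h hs.1).1 hs.2
  have h2 := arcLen_add (eVariationOn_Icc_ne_top h le_rfl ht.2) hs.1.1 hst.le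
  have h3 := arcLen_nonneg f s t
  linarith

lemma arcTime_le_of_le_arcLen {f : ℝ → E} {a b u : ℝ} (h : eVariationOn f (Icc a b) ≠ ⊤)
    {t : ℝ} (ht : t ∈ Icc a b) (hut : u ≤ arcLen f a t) :
    arcTime f a b u ≤ t :=
  csInf_le ⟨a, fun _ ht => ht.1.1⟩ ⟨ht, (ofReal_le_eVariationOn_iff h ht).2 hut⟩

/-- The arclength parametrization is `1`-Lipschitz, in a form that avoids continuity of the
length function. -/
lemma dist_arcTime_le {f : ℝ → E} {a b u : ℝ} (h : eVariationOn f (Icc a b) ≠ ⊤)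
    (hab : a ≤ b) (hu : u ≤ arcLen f a b) (hf : ContinuousOn f (Icc a b)) {t : ℝ}
    (ht : t ∈ Icc a b) :
    dist (f (arcTime f a b u)) (f t) ≤ |u - arcLen f a t| := by
  set τ := arcTime f a b u with hτ
  have hτm : τ ∈ Icc a b := arcTime_mem h hab hu
  rcases lt_trichotomy τ t with hlt | heq | hlt
  · have : (𝓝[Ioo τ t] τ).NeBot := left_nhdsWithin_Ioo_neBot hlt
    have hsub : Ioo τ t ⊆ Icc a b := fun x hx => ⟨hτm.1.trans hx.1.le, hx.2.le.trans ht.2⟩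
    have hc : Tendsto (fun x => dist (f x) (f t)) (𝓝[Ioo τ t] τ) (𝓝 (dist (f τ) (f t))) :=
      ((hf τ hτm).mono hsub).dist tendsto_const_nhds
    refine le_of_tendsto hc (eventually_nhdsWithin_of_forall fun x hx => ?_)
    have h1 := dist_le_arcLen (eVariationOn_Icc_ne_top h (hsub hx).1 ht.2) hx.2.le
    have h2 := arcLen_add (eVariationOn_Icc_ne_top h le_rfl ht.2) (hsub hx).1 hx.2.le
    have h3 := le_arcLen_of_arcTime_lt h hab hu (hsub hx) hx.1
    rw [abs_sub_comm]
    exact le_trans (by linarith) (le_abs_self _)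
  · rw [heq, dist_self]
    exact abs_nonneg _
  · have : (𝓝[Ioo t τ] τ).NeBot := right_nhdsWithin_Ioo_neBot hlt
    have hsub : Ioo t τ ⊆ Icc a b := fun x hx => ⟨ht.1.trans hx.1.le, hx.2.le.trans hτm.2⟩
    have hc : Tendsto (fun x => dist (f x) (f t)) (𝓝[Ioo t τ] τ) (𝓝 (dist (f τ) (f t))) :=
      ((hf τ hτm).mono hsub).dist tendsto_const_nhds
    refine le_of_tendsto hc (eventually_nhdsWithin_of_forall fun x hx => ?_)
    have h1 := dist_le_arcLen (eVariationOn_Icc_ne_top h ht.1 (hsub hx).2) hx.1.le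
    have h2 := arcLen_add (eVariationOn_Icc_ne_top h le_rfl (hsub hx).2) ht.1 hx.1.le
    have h3 : arcLen f a x < u := by
      by_contra hcon
      exact absurd (arcTime_le_of_le_arcLen h (hsub hx) (not_lt.1 hcon)) (not_le.2 hx.2)
    rw [dist_comm]
    exact le_trans (by linarith) (le_abs_self _)

lemma arcTime_shift {f : ℝ → E} {a a' b b' u : ℝ} (h : eVariationOn f (Icc a' b') ≠ ⊤)
    (ha : a' ≤ a) (hab : a ≤ b) (hb : b ≤ b') (hu0 : 0 < u) (hu : u < arcLen f a b) :
    arcTime f a' b' (u + arcLen f a' a) = arcTime f a b u := by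
  have hh := eVariationOn_Icc_ne_top h ha hb
  have key : ∀ t, a ≤ t → t ≤ b' → (u + arcLen f a' a ≤ arcLen f a' t ↔ u ≤ arcLen f a t) := by
    intro t hat htb
    have := arcLen_add (eVariationOn_Icc_ne_top h le_rfl htb) ha hat
    constructor <;> intro <;> linarith
  have hbS : b ∈ {t | t ∈ Icc a b ∧ ENNReal.ofReal u ≤ eVariationOn f (Icc a t)} :=
    ⟨right_mem_Icc.2 hab, (ofReal_le_eVariationOn_iff hh (right_mem_Icc.2 hab)).2 hu.le⟩
  have hsub : {t | t ∈ Icc a b ∧ ENNReal.ofReal u ≤ eVariationOn f (Icc a t)} ⊆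
      {t | t ∈ Icc a' b' ∧ ENNReal.ofReal (u + arcLen f a' a) ≤ eVariationOn f (Icc a' t)} := by
    rintro t ⟨ht, htu⟩
    have ht' : t ∈ Icc a' b' := ⟨ha.trans ht.1, ht.2.trans hb⟩
    exact ⟨ht', (ofReal_le_eVariationOn_iff h ht').2
      ((key t ht.1 ht'.2).2 ((ofReal_le_eVariationOn_iff hh ht).1 htu))⟩
  refine le_antisymm (csInf_le_csInf ⟨a', fun _ ht => ht.1.1⟩ ⟨b, hbS⟩ hsub)
    (le_csInf ⟨b, hsub hbS⟩ ?_)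
  rintro t ⟨ht, htu⟩
  rw [ofReal_le_eVariationOn_iff h ht] at htu
  have hat : a ≤ t := by
    by_contra hlt
    have h1 := arcLen_add (eVariationOn_Icc_ne_top h le_rfl (hab.trans hb)) ht.1 (not_le.1 hlt).le
    have h2 := arcLen_nonneg f t a
    linarith
  have hut := (key t hat ht.2).1 htu
  rcases le_total t b with htb | htb
  · exact arcTime_le_of_le_arcLen hh ⟨hat, htb⟩ hut
  · exact (csInf_le ⟨a, fun _ ht => ht.1.1⟩ hbS).trans htb

end ArcLength

section ArcIntegral

lemma arcIntegralOn_eq (ρ : ↥Sphere2 → ℝ≥0∞) (f : ℝ → ↥Sphere2) (a b : ℝ) :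
    arcIntegralOn ρ f a b = ∫⁻ u in Ico 0 (arcLen f a b), ρ (f (arcTime f a b u)) := rfl

lemma arcIntegralOn_eq_shift (ρ : ↥Sphere2 → ℝ≥0∞) {f : ℝ → ↥Sphere2} {a a' b b' : ℝ}
    (h : eVariationOn f (Icc a' b') ≠ ⊤) (ha : a' ≤ a) (hab : a ≤ b) (hb : b ≤ b') :
    arcIntegralOn ρ f a b =
      ∫⁻ w in Ico (arcLen f a' a) (arcLen f a' b), ρ (f (arcTime f a' b' w)) := by
  have hadd := arcLen_add (eVariationOn_Icc_ne_top h le_rfl hb) ha hab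
  have hpre : (fun u => u + arcLen f a' a) ⁻¹' Ico (arcLen f a' a) (arcLen f a' b) =
      Ico 0 (arcLen f a b) := by
    rw [preimage_add_const_Ico, ← hadd]
    simp
  rw [← (measurePreserving_add_right volume (arcLen f a' a)).setLIntegral_comp_preimage_emb
    (measurableEmbedding_addRight _) , hpre, arcIntegralOn_eq,
    setLIntegral_congr Ioo_ae_eq_Ico.symm, setLIntegral_congr Ioo_ae_eq_Ico.symm]
  refine setLIntegral_congr_fun measurableSet_Ioo fun u hu => ?_
  rw [arcTime_shift h ha hab hb hu.1 hu.2]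

lemma arcIntegralOn_add (ρ : ↥Sphere2 → ℝ≥0∞) {f : ℝ → ↥Sphere2} {a b c : ℝ}
    (h : eVariationOn f (Icc a c) ≠ ⊤) (hab : a ≤ b) (hbc : b ≤ c) :
    arcIntegralOn ρ f a b + arcIntegralOn ρ f b c = arcIntegralOn ρ f a c := by
  rw [arcIntegralOn_eq_shift ρ h le_rfl hab hbc, arcIntegralOn_eq_shift ρ h hab hbc le_rfl,
    arcIntegralOn_eq ρ f a c, arcLen_self]
  have hadd := arcLen_add h hab hbc
  have h1 := arcLen_nonneg f a b
  have h2 := arcLen_nonneg f b c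
  rw [← lintegral_union measurableSet_Ico (Ico_disjoint_Ico_same),
    Ico_union_Ico_eq_Ico h1 (by linarith)]

lemma arcIntegralOn_mono_interval (ρ : ↥Sphere2 → ℝ≥0∞) {f : ℝ → ↥Sphere2} {a a' b b' : ℝ}
    (h : eVariationOn f (Icc a' b') ≠ ⊤) (ha : a' ≤ a) (hab : a ≤ b) (hb : b ≤ b') :
    arcIntegralOn ρ f a b ≤ arcIntegralOn ρ f a' b' := by
  rw [← arcIntegralOn_add ρ h (ha.trans hab) hb,
    ← arcIntegralOn_add ρ (eVariationOn_Icc_ne_top h le_rfl hb) ha hab, add_assoc]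
  exact le_add_left (le_add_right le_rfl)

lemma arcIntegralOn_mono {ρ ρ' : ↥Sphere2 → ℝ≥0∞} (h : ∀ x, ρ x ≤ ρ' x) (f : ℝ → ↥Sphere2)
    (a b : ℝ) : arcIntegralOn ρ f a b ≤ arcIntegralOn ρ' f a b :=
  lintegral_mono fun _ => h _

lemma arcIntegralOn_of_lt (ρ : ↥Sphere2 → ℝ≥0∞) (f : ℝ → ↥Sphere2) {a b : ℝ} (h : b < a) :
    arcIntegralOn ρ f a b = 0 := by
  simp [arcIntegralOn_eq, arcLen, Icc_eq_empty_of_lt h]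

lemma sum_mul_arcIntegralOn_le {ι : Type*} (s : Finset ι) (w : ι → NNReal)
    (g : ι → ↥Sphere2 → ℝ≥0∞) (f : ℝ → ↥Sphere2) (a b : ℝ) :
    ∑ j ∈ s, (w j : ℝ≥0∞) * arcIntegralOn (g j) f a b ≤
      arcIntegralOn (fun x => ∑ j ∈ s, (w j : ℝ≥0∞) * g j x) f a b := by
  classical
  induction s using Finset.induction_on with
  | empty => simp
  | insert i s hi ih =>
    simp only [Finset.sum_insert hi]
    refine (add_le_add_right ih _).trans ?_
    simp only [arcIntegralOn_eq]
    rw [← lintegral_const_mul' _ _ ENNReal.coe_ne_top]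
    exact le_lintegral_add _ _

lemma lineIntegral_mono {ρ ρ' : ↥Sphere2 → ℝ≥0∞} (h : ∀ x, ρ x ≤ ρ' x) (γ : SpherePath) :
    γ.lineIntegral ρ ≤ γ.lineIntegral ρ' :=
  iSup_mono fun _ => iSup_mono fun _ => iSup_mono fun _ => arcIntegralOn_mono h _ _ _

lemma arcIntegralOn_le_lineIntegral {γ : SpherePath} {a b : ℝ} (h : Icc a b ⊆ γ.I)
    (ρ : ↥Sphere2 → ℝ≥0∞) : arcIntegralOn ρ γ.toFun a b ≤ γ.lineIntegral ρ :=
  le_iSup_of_le a (le_iSup_of_le b (le_iSup_of_le h le_rfl))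

lemma SpherePath.ordConnected (γ : SpherePath) : γ.I.OrdConnected := by
  obtain ⟨a, b, -, h | h | h | h⟩ := γ.hI <;> rw [h] <;> infer_instance

lemma exists_lt_arcIntegralOn {γ : SpherePath} {ρ : ↥Sphere2 → ℝ≥0∞} {c : ℝ≥0∞}
    (h : c < γ.lineIntegral ρ) :
    ∃ a b, a ≤ b ∧ Icc a b ⊆ γ.I ∧ c < arcIntegralOn ρ γ.toFun a b := by
  simp only [SpherePath.lineIntegral, lt_iSup_iff] at h
  obtain ⟨a, b, hI, hc⟩ := h
  refine ⟨a, b, ?_, hI, hc⟩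
  by_contra hlt
  rw [arcIntegralOn_of_lt _ _ (not_le.1 hlt)] at hc
  exact not_lt_zero hc

lemma lineIntegral_add_le {γ : SpherePath} (hγ : γ.LocRectifiable) (ρ ρ' : ↥Sphere2 → ℝ≥0∞) :
    γ.lineIntegral ρ + γ.lineIntegral ρ' ≤ γ.lineIntegral fun x => ρ x + ρ' x := by
  refine le_of_forall_lt fun c hc => ?_
  obtain ⟨p, q, hp, hq, hpq⟩ : ∃ p q, (p < γ.lineIntegral ρ ∨ p = 0) ∧
      (q < γ.lineIntegral ρ' ∨ q = 0) ∧ c < p + q := by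
    rcases eq_or_ne (γ.lineIntegral ρ) 0 with h0 | h0
    · rw [h0, zero_add] at hc
      obtain ⟨q, hq1, hq2⟩ := exists_between hc
      exact ⟨0, q, Or.inr rfl, Or.inl hq2, by simpa using hq1⟩
    rcases eq_or_ne (γ.lineIntegral ρ') 0 with h0' | h0'
    · rw [h0', add_zero] at hc
      obtain ⟨q, hq1, hq2⟩ := exists_between hc
      exact ⟨q, 0, Or.inl hq2, Or.inr rfl, by simpa using hq1⟩
    obtain ⟨p, hp, q, hq, h⟩ := ENNReal.exists_lt_add_of_lt_add hc h0 h0'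
    exact ⟨p, q, Or.inl hp, Or.inl hq, h⟩
  have hex : ∀ (τ : ↥Sphere2 → ℝ≥0∞) (r : ℝ≥0∞), (r < γ.lineIntegral τ ∨ r = 0) →
      ∃ a b, a ≤ b ∧ Icc a b ⊆ γ.I ∧ r ≤ arcIntegralOn τ γ.toFun a b := by
    rintro τ r (h | rfl)
    · obtain ⟨a, b, h1, h2, h3⟩ := exists_lt_arcIntegralOn h
      exact ⟨a, b, h1, h2, h3.le⟩
    · obtain ⟨a, b, hab, hI⟩ := γ.hI
      obtain ⟨t, ht⟩ : (Ioo a b).Nonempty := nonempty_Ioo.2 hab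
      refine ⟨t, t, le_rfl, ?_, zero_le⟩
      rw [Icc_self, singleton_subset_iff]
      rcases hI with h | h | h | h <;> rw [h]
      exacts [Ioo_subset_Icc_self ht, Ioo_subset_Ico_self ht, Ioo_subset_Ioc_self ht, ht]
  obtain ⟨a, b, hab, hI, hle⟩ := hex ρ p hp
  obtain ⟨a', b', hab', hI', hle'⟩ := hex ρ' q hq
  have hI'' : Icc (min a a') (max b b') ⊆ γ.I := by
    refine γ.ordConnected.out ?_ ?_
    · rcases min_choice a a' with h | h <;> rw [h]
      exacts [hI (left_mem_Icc.2 hab), hI' (left_mem_Icc.2 hab')]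
    · rcases max_choice b b' with h | h <;> rw [h]
      exacts [hI (right_mem_Icc.2 hab), hI' (right_mem_Icc.2 hab')]
  have hfin := (hγ _ _ hI'').ne
  refine hpq.trans_le (le_trans ?_ (arcIntegralOn_le_lineIntegral hI'' _))
  refine (add_le_add
    (hle.trans (arcIntegralOn_mono_interval ρ hfin (min_le_left _ _) hab (le_max_left _ _)))
    (hle'.trans (arcIntegralOn_mono_interval ρ' hfin (min_le_right _ _) hab'
      (le_max_right _ _)))).trans ?_
  exact le_lintegral_add _ _

lemma sum_lineIntegral_le {γ : SpherePath} (hγ : γ.LocRectifiable) {ι : Type*} (s : Finset ι)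
    (ρ : ι → ↥Sphere2 → ℝ≥0∞) :
    ∑ i ∈ s, γ.lineIntegral (ρ i) ≤ γ.lineIntegral fun x => ∑ i ∈ s, ρ i x := by
  classical
  induction s using Finset.induction_on with
  | empty => simp
  | insert i s hi ih =>
    simp only [Finset.sum_insert hi]
    exact (add_le_add_right ih _).trans (lineIntegral_add_le hγ _ _)

end ArcIntegral

section NullFamilies

/-- A path family is null if and only if some `L²` density has infinite line integral along
all of its locally rectifiable members. -/
lemma conformalModulus_eq_zero_iff (Γ : Set SpherePath) :
    conformalModulus Γ = 0 ↔ ∃ ρ : ↥Sphere2 → ℝ≥0∞, Measurable ρ ∧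
      ∫⁻ x, ρ x ^ 2 ∂sphereMeasure < ⊤ ∧
        ∀ γ ∈ Γ, γ.LocRectifiable → γ.lineIntegral ρ = ⊤ := by
  constructor
  · intro h0
    have hex : ∀ n : ℕ, ∃ ρ : ↥Sphere2 → ℝ≥0∞, Measurable ρ ∧
        (∀ γ ∈ Γ, γ.LocRectifiable → 1 ≤ γ.lineIntegral ρ) ∧
        eLpNorm ρ 2 sphereMeasure ≤ 2⁻¹ ^ n := by
      intro n
      have hlt : conformalModulus Γ < (2⁻¹ ^ n) ^ 2 := by
        rw [h0]
        exact pos_iff_ne_zero.2 (by simp)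
      simp only [conformalModulus, iInf_lt_iff] at hlt
      obtain ⟨ρ, hm, had, hlt⟩ := hlt
      refine ⟨ρ, hm, had, ?_⟩
      have h1 := eLpNorm_two_sq sphereMeasure ρ
      simp only [enorm_eq_self] at h1
      rw [← h1] at hlt
      exact (lt_of_pow_lt_pow_left' 2 hlt).le
    choose ρ hm had hnorm using hex
    refine ⟨fun x => ∑' n, ρ n x, Measurable.tsum hm,
      lintegral_sq_tsum_lt_top _ ρ hm hnorm, fun γ hγ hrect => ?_⟩
    refine ENNReal.eq_top_of_forall_nnreal_le fun r => ?_
    obtain ⟨n, hn⟩ := exists_nat_ge r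
    calc (r : ℝ≥0∞) ≤ n := by exact_mod_cast hn
      _ = ∑ i ∈ Finset.range n, (1 : ℝ≥0∞) := by simp
      _ ≤ ∑ i ∈ Finset.range n, γ.lineIntegral (ρ i) :=
          Finset.sum_le_sum fun i _ => had i γ hγ hrect
      _ ≤ _ := (sum_lineIntegral_le hrect _ _).trans
          (lineIntegral_mono (fun x => ENNReal.sum_le_tsum _) γ)
  · rintro ⟨ρ, hm, hfin, htop⟩
    refine nonpos_iff_eq_zero.1 (le_of_forall_gt fun c hc => ?_)
    set A := ∫⁻ x, ρ x ^ 2 ∂sphereMeasure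
    obtain ⟨ε, hε, hεc⟩ : ∃ ε : NNReal, 0 < ε ∧ (ε : ℝ≥0∞) ^ 2 * A < c := by
      have ht : Tendsto (fun ε : NNReal => (ε : ℝ≥0∞) ^ 2 * A) (𝓝 0) (𝓝 (0 ^ 2 * A)) := by
        have h1 : Tendsto (fun ε : NNReal => (ε : ℝ≥0∞) ^ 2) (𝓝 0) (𝓝 (0 ^ 2)) :=
          ((ENNReal.continuous_pow 2).comp ENNReal.continuous_coe).tendsto' _ _ (by simp)
        exact ENNReal.Tendsto.mul_const h1 (Or.inr hfin.ne)
      have hev := ht.eventually (gt_mem_nhds (by simpa using hc))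
      obtain ⟨ε, h1, h2⟩ := ((hev.filter_mono nhdsWithin_le_nhds).and
        (self_mem_nhdsWithin (s := Ioi (0 : NNReal)))).exists
      exact ⟨ε, h2, h1⟩
    refine lt_of_le_of_lt ?_ hεc
    refine iInf_le_of_le (fun x => ε * ρ x) (iInf_le_of_le (hm.const_mul _)
      (iInf_le_of_le (fun γ hγ hrect => ?_) ?_))
    · have h1 := htop γ hγ hrect
      have h2 : γ.lineIntegral (fun x => ε * ρ x) = ε * γ.lineIntegral ρ := by
        simp only [SpherePath.lineIntegral, ENNReal.mul_iSup, arcIntegralOn_eq]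
        simp only [lintegral_const_mul' _ _ (ENNReal.coe_ne_top (r := ε))]
      rw [h2, h1, ENNReal.mul_top (by simpa using hε.ne')]
      exact le_top
    · simp only [mul_pow]
      rw [lintegral_const_mul' _ _ (by simp)]

lemma conformalModulus_biUnion_eq_zero {ι : Type*} (s : Finset ι) (Γ : ι → Set SpherePath)
    (h : ∀ i ∈ s, conformalModulus (Γ i) = 0) : conformalModulus (⋃ i ∈ s, Γ i) = 0 := by
  classical
  induction s using Finset.induction_on with
  | empty =>
    rw [conformalModulus_eq_zero_iff]
    exact ⟨0, measurable_const, by simp, by simp⟩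
  | insert i s hi ih =>
    have h1 := h i (Finset.mem_insert_self _ _)
    have h2 := ih fun j hj => h j (Finset.mem_insert_of_mem hj)
    rw [conformalModulus_eq_zero_iff] at h1 h2 ⊢
    obtain ⟨ρ, hm, hfin, htop⟩ := h1
    obtain ⟨ρ', hm', hfin', htop'⟩ := h2
    refine ⟨fun x => ρ x + ρ' x, hm.add hm', lintegral_sq_add_lt_top hm hfin hfin',
      fun γ hγ hrect => ?_⟩
    rw [Finset.set_biUnion_insert] at hγ
    refine top_le_iff.1 ?_
    rcases hγ with hγ | hγ
    · rw [← htop γ hγ hrect]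
      exact lineIntegral_mono (fun x => le_add_right le_rfl) γ
    · rw [← htop' γ hγ hrect]
      exact lineIntegral_mono (fun x => le_add_left le_rfl) γ

lemma conformalModulus_eq_zero_of_subset {Γ Γ' : Set SpherePath} (h : Γ ⊆ Γ')
    (h0 : conformalModulus Γ' = 0) : conformalModulus Γ = 0 := by
  rw [conformalModulus_eq_zero_iff] at h0 ⊢
  obtain ⟨ρ, hm, hfin, htop⟩ := h0
  exact ⟨ρ, hm, hfin, fun γ hγ => htop γ (h hγ)⟩

end NullFamilies

section Nets

lemma exists_finset_separated_net {X : Type*} [MetricSpace X] [CompactSpace X] (A : Set X)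
    {ε : ℝ} (hε : 0 < ε) :
    ∃ t : Finset X, (∀ x ∈ t, x ∈ A) ∧ (∀ x ∈ t, ∀ y ∈ t, x ≠ y → ε < dist x y) ∧
      ∀ x ∈ A, ∃ y ∈ t, dist x y ≤ ε := by
  let δ : NNReal := ⟨ε / 2, by positivity⟩
  have hδ : δ ≠ 0 := fun h => by
    have : (δ : ℝ) = 0 := by rw [h]; rfl
    change ε / 2 = 0 at this
    linarith
  have hcov : ((2 * δ : NNReal) : ℝ≥0∞) = ENNReal.ofReal ε := by
    rw [ENNReal.ofReal, ENNReal.coe_inj, ← NNReal.coe_inj, Real.coe_toNNReal _ hε.le]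
    change 2 * (ε / 2) = ε
    ring
  have hfin : packingNumber (2 * δ) A ≠ ⊤ := by
    obtain ⟨N, -, hN, hNc⟩ := exists_finite_isCover_of_isCompact hδ (isCompact_univ (X := X))
    refine ne_top_of_le_ne_top ?_ (packingNumber_two_mul_le_externalCoveringNumber δ A)
    refine ne_top_of_le_ne_top (encard_ne_top_iff.2 hN) ?_
    exact IsCover.externalCoveringNumber_le_encard (hNc.anti (subset_univ A))
  have hmf : (maximalSeparatedSet (2 * δ) A).Finite := by
    rw [← encard_ne_top_iff, encard_maximalSeparatedSet hfin]
    exact hfin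
  refine ⟨hmf.toFinset, fun x hx => maximalSeparatedSet_subset (hmf.mem_toFinset.1 hx),
    fun x hx y hy hxy => ?_, fun x hx => ?_⟩
  · have := isSeparated_maximalSeparatedSet (hmf.mem_toFinset.1 hx) (hmf.mem_toFinset.1 hy) hxy
    simp only [hcov, edist_dist] at this
    exact (ENNReal.ofReal_lt_ofReal_iff_of_nonneg hε.le).1 this
  · obtain ⟨y, hy, hxy⟩ := isCover_maximalSeparatedSet hfin hx
    refine ⟨y, hmf.mem_toFinset.2 hy, ?_⟩
    simp only [hcov, edist_dist] at hxy
    exact (ENNReal.ofReal_le_ofReal_iff hε.le).1 hxy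

/-- Doubled balls centered at a separated net have uniformly bounded overlap. -/
lemma exists_card_filter_dist_le : ∃ N : ℕ, ∀ ε : ℝ, 0 < ε → ε ≤ 2 / 5 →
    ∀ t : Finset ↥Sphere2, (∀ x ∈ t, ∀ y ∈ t, x ≠ y → ε < dist x y) →
      ∀ x, (t.filter fun y => dist x y < 2 * ε).card ≤ N := by
  obtain ⟨c, hc0, hct, hc⟩ := sphereMeasure_ball_ge
  obtain ⟨C, hCt, hC⟩ := sphereMeasure_ball_le
  obtain ⟨N, hN⟩ := ENNReal.exists_nat_gt (r := C * 25 / c)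
    (ENNReal.div_ne_top (ENNReal.mul_ne_top hCt (by simp)) hc0)
  refine ⟨N, fun ε hε hε1 t ht x => ?_⟩
  set s := t.filter fun y => dist x y < 2 * ε with hs
  have hdisj : (s : Set ↥Sphere2).PairwiseDisjoint fun y => ball y (ε / 2) := by
    intro y hy z hz hyz
    refine ball_disjoint_ball ?_
    have := ht y (Finset.mem_filter.1 hy).1 z (Finset.mem_filter.1 hz).1 hyz
    linarith
  have hsub : (⋃ y ∈ s, ball y (ε / 2)) ⊆ ball x (5 / 2 * ε) := by
    intro z hz
    simp only [mem_iUnion, mem_ball, exists_prop] at hz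
    obtain ⟨y, hy, hzy⟩ := hz
    have h1 := (Finset.mem_filter.1 hy).2
    have h2 := dist_triangle z y x
    rw [dist_comm y x] at h2
    rw [mem_ball]
    linarith
  have h1 : (s.card : ℝ≥0∞) * (c * ENNReal.ofReal (ε / 2) ^ 2) ≤
      C * ENNReal.ofReal (5 / 2 * ε) ^ 2 := by
    calc (s.card : ℝ≥0∞) * (c * ENNReal.ofReal (ε / 2) ^ 2)
        = ∑ y ∈ s, c * ENNReal.ofReal (ε / 2) ^ 2 := by simp
      _ ≤ ∑ y ∈ s, sphereMeasure (ball y (ε / 2)) :=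
          Finset.sum_le_sum fun y _ => hc y _ (by positivity) (by linarith)
      _ = sphereMeasure (⋃ y ∈ s, ball y (ε / 2)) :=
          (measure_biUnion_finset hdisj fun y _ => measurableSet_ball).symm
      _ ≤ sphereMeasure (ball x (5 / 2 * ε)) := measure_mono hsub
      _ ≤ _ := hC x _ (by positivity) (by linarith)
  have h2 : ENNReal.ofReal (5 / 2 * ε) = 5 * ENNReal.ofReal (ε / 2) := by
    rw [show 5 / 2 * ε = 5 * (ε / 2) by ring, ENNReal.ofReal_mul (by norm_num)]
    simp
  rw [h2, mul_pow, ← mul_assoc, ← mul_assoc] at h1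
  have h3 : (s.card : ℝ≥0∞) * c ≤ C * 25 := by
    have h5 : ENNReal.ofReal (ε / 2) ^ 2 ≠ 0 := by
      simpa using hε
    refine (ENNReal.mul_le_mul_iff_left h5 (by simp)).1 ?_
    convert h1 using 3
    norm_num
  have h4 : (s.card : ℝ≥0∞) ≤ C * 25 / c :=
    (ENNReal.le_div_iff_mul_le (Or.inl hc0) (Or.inl hct)).2 h3
  exact_mod_cast (h4.trans_lt hN).le

end Nets

section Quasiconformal

/-- The points at which `f` has metric distortion at most `K` at all scales below `1/(j+1)`. -/
def distortionSet (f : ↥Sphere2 → ↥Sphere2) (K : ℝ) (j : ℕ) : Set ↥Sphere2 :=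
  {x | ∀ r : ℝ, 0 < r → r < 1 / ((j : ℝ) + 1) → ∀ y z, dist x y ≤ r → r ≤ dist x z →
    dist (f x) (f y) ≤ K * dist (f x) (f z)}

lemma monotone_distortionSet (f : ↥Sphere2 → ↥Sphere2) (K : ℝ) :
    Monotone (distortionSet f K) := by
  intro i j hij x hx r hr0 hr y z hy hz
  refine hx r hr0 (hr.trans_le ?_) y z hy hz
  have : (i : ℝ) ≤ j := by exact_mod_cast hij
  gcongr

lemma exists_iUnion_distortionSet {f : ↥Sphere2 → ↥Sphere2}
    (hf : IsQuasiconformalOn f univ univ) :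
    ∃ K : ℝ, 1 ≤ K ∧ ⋃ j, distortionSet f K j = univ := by
  obtain ⟨-, -, -, -, -, H, hH, hlim⟩ := hf
  have hH1 : H + 1 ≠ ⊤ := by simpa using hH.ne
  refine ⟨(H + 1).toReal, ?_, eq_univ_of_forall fun x => ?_⟩
  · rw [← ENNReal.toReal_one]
    exact ENNReal.toReal_mono hH1 (by simp)
  have hev := eventually_lt_of_limsup_lt
    ((hlim x (mem_univ x)).trans_lt (ENNReal.lt_add_right hH.ne one_ne_zero))
  obtain ⟨δ, hδ, hev⟩ := mem_nhdsGT_iff_exists_Ioo_subset.1 hev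
  obtain ⟨j, hj⟩ := exists_nat_one_div_lt (mem_Ioi.1 hδ)
  refine mem_iUnion.2 ⟨j, fun r hr0 hr y z hy hz => ?_⟩
  have h1 : qcRatioOn f univ x r ≤ H + 1 := le_of_lt (hev ⟨hr0, hr.trans hj⟩)
  rw [qcRatioOn, ENNReal.div_le_iff_le_mul (Or.inr hH1) (Or.inr (by simp))] at h1
  have h2 : ENNReal.ofReal (dist (f x) (f y)) ≤ (H + 1) * ENNReal.ofReal (dist (f x) (f z)) :=
    (le_iSup₂_of_le y ⟨mem_univ y, hy⟩ le_rfl).trans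
      (h1.trans (mul_le_mul_right (iInf₂_le z ⟨mem_univ z, hz⟩) _))
  have h3 := ENNReal.toReal_mono (ENNReal.mul_ne_top hH1 ENNReal.ofReal_ne_top) h2
  rwa [ENNReal.toReal_mul, ENNReal.toReal_ofReal dist_nonneg,
    ENNReal.toReal_ofReal dist_nonneg] at h3

lemma exists_image_radius {f : ↥Sphere2 → ↥Sphere2} (hf : Continuous f) (x : ↥Sphere2) {ε : ℝ}
    (hε : 0 ≤ ε) : ∃ l : NNReal, (∀ y, dist x y ≤ ε → dist (f x) (f y) ≤ l) ∧
      ∃ y, dist x y ≤ ε ∧ dist (f x) (f y) = l := by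
  have hc : IsCompact (closedBall x ε) := isClosed_closedBall.isCompact
  obtain ⟨y, hy, hmax⟩ := hc.exists_isMaxOn ⟨x, mem_closedBall_self hε⟩
    (continuous_const.dist hf : Continuous fun y => dist (f x) (f y)).continuousOn
  refine ⟨⟨dist (f x) (f y), dist_nonneg⟩, fun z hz => hmax (mem_closedBall'.2 hz), y,
    mem_closedBall'.1 hy, rfl⟩

lemma ball_subset_image_ball (f : ↥Sphere2 ≃ₜ ↥Sphere2) {K ε l : ℝ} {j : ℕ} {x y : ↥Sphere2}
    (hx : x ∈ distortionSet f K j) (hK : 0 < K) (hε0 : 0 < ε) (hε : ε < 1 / ((j : ℝ) + 1))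
    (hxy : dist x y ≤ ε) (hl : dist (f x) (f y) = l) :
    ball (f x) (l / K) ⊆ f '' ball x ε := by
  intro w hw
  refine ⟨f.symm w, ?_, by simp⟩
  by_contra hcon
  rw [mem_ball', not_lt] at hcon
  have := hx ε hε0 hε y (f.symm w) hxy hcon
  rw [f.apply_symm_apply, hl] at this
  rw [mem_ball', lt_div_iff₀ hK] at hw
  linarith

open Classical in
lemma sq_sum_indicator_le {X : Type*} {N : ℕ} (t : Finset X) (B : X → Set X) (a : X → NNReal)
    (x : X) (hN : (t.filter fun i => x ∈ B i).card ≤ N) :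
    (∑ i ∈ t, (B i).indicator (fun _ => a i) x) ^ 2 ≤
      N * ∑ i ∈ t, (B i).indicator (fun _ => a i ^ 2) x := by
  simp only [indicator_apply]
  rw [← Finset.sum_filter, ← Finset.sum_filter]
  exact sq_sum_le_card_mul_sum_sq.trans (mul_le_mul_left (by exact_mod_cast hN) _)

/-- The scale of the net used for the `j`-th discretization. -/
noncomputable def netScale (j : ℕ) : NNReal := (5 * ((j : NNReal) + 1))⁻¹

lemma netScale_pos (j : ℕ) : 0 < netScale j := by
  unfold netScale
  positivity

lemma netScale_lt (j : ℕ) : (netScale j : ℝ) < 1 / ((j : ℝ) + 1) := by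
  unfold netScale
  push_cast
  rw [← one_div]
  have : (0 : ℝ) ≤ j := j.cast_nonneg
  exact one_div_lt_one_div_of_lt (by linarith) (by linarith)

lemma netScale_le (j : ℕ) : (netScale j : ℝ) ≤ 1 / 5 := by
  unfold netScale
  push_cast
  rw [← one_div]
  have : (0 : ℝ) ≤ j := j.cast_nonneg
  exact one_div_le_one_div_of_le (by linarith) (by linarith)

/-- A weighted sum of indicator functions of balls of radius `2 ε`. -/
noncomputable def ballDensity (t : Finset ↥Sphere2) (ε : NNReal) (a : ↥Sphere2 → NNReal)
    (x : ↥Sphere2) : NNReal :=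
  ∑ i ∈ t, (ball i (2 * ε)).indicator (fun _ => a i) x

lemma measurable_ballDensity (t : Finset ↥Sphere2) (ε : NNReal) (a : ↥Sphere2 → NNReal) :
    Measurable (ballDensity t ε a) :=
  Finset.measurable_sum _ fun _ _ => measurable_const.indicator measurableSet_ball

lemma lintegral_sq_ballDensity_le {t : Finset ↥Sphere2} {ε : NNReal} (a : ↥Sphere2 → NNReal)
    {N : ℕ} (hN : ∀ x, (t.filter fun y => dist x y < 2 * ε).card ≤ N) :
    ∫⁻ x, (ballDensity t ε a x : ℝ≥0∞) ^ 2 ∂sphereMeasure ≤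
      N * ∑ i ∈ t, (a i : ℝ≥0∞) ^ 2 * sphereMeasure (ball i (2 * ε)) := by
  classical
  have hle : ∀ x, (ballDensity t ε a x : ℝ≥0∞) ^ 2 ≤
      N * ∑ i ∈ t, (ball i (2 * ε)).indicator (fun _ => (a i : ℝ≥0∞) ^ 2) x := by
    intro x
    have h1 := sq_sum_indicator_le (N := N) t (fun i => ball i (2 * ε)) a x (by
      simp only [mem_ball]
      convert hN x)
    have h2 : ∀ i, (ball i (2 * (ε : ℝ))).indicator (fun _ => (a i : ℝ≥0∞) ^ 2) x =
        (((ball i (2 * (ε : ℝ))).indicator (fun _ => a i ^ 2) x : NNReal) : ℝ≥0∞) := by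
      intro i
      simp only [indicator_apply]
      split_ifs <;> simp
    simp only [h2]
    unfold ballDensity
    exact_mod_cast h1
  refine (lintegral_mono hle).trans ?_
  rw [lintegral_const_mul' _ _ (by simp), lintegral_finsetSum _ fun i _ =>
    measurable_const.indicator measurableSet_ball]
  simp only [lintegral_indicator_const measurableSet_ball, le_refl]

lemma sum_setLIntegral_image_ball_le (f : ↥Sphere2 ≃ₜ ↥Sphere2) {ρ : ↥Sphere2 → ℝ≥0∞}
    (hρ : Measurable ρ) {t : Finset ↥Sphere2} {ε : NNReal} {N : ℕ}
    (hN : ∀ x, (t.filter fun y => dist x y < 2 * ε).card ≤ N) :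
    ∑ i ∈ t, ∫⁻ x in f '' ball i ε, ρ x ^ 2 ∂sphereMeasure ≤
      N * ∫⁻ x, ρ x ^ 2 ∂sphereMeasure := by
  classical
  have hmeas : ∀ i, MeasurableSet (f '' ball i ε) := fun i =>
    (f.isOpenMap _ isOpen_ball).measurableSet
  simp only [← lintegral_indicator (hmeas _)]
  rw [← lintegral_finsetSum _ fun i _ => (hρ.pow_const 2).indicator (hmeas i),
    ← lintegral_const_mul' _ _ (by simp)]
  refine lintegral_mono fun x => ?_
  simp only [indicator_apply]
  rw [← Finset.sum_filter, Finset.sum_const, nsmul_eq_mul]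
  refine mul_le_mul_left ?_ _
  have h1 : (t.filter fun i => x ∈ f '' ball i ε) ⊆
      t.filter fun y => dist (f.symm x) y < 2 * ε := by
    intro i hi
    rw [Finset.mem_filter] at hi ⊢
    refine ⟨hi.1, ?_⟩
    obtain ⟨z, hz, rfl⟩ := hi.2
    rw [f.symm_apply_apply]
    rw [mem_ball] at hz
    have : (0 : ℝ) ≤ ε := ε.coe_nonneg
    linarith
  exact_mod_cast (Finset.card_le_card h1).trans (hN _)

/-- Discretization of the pull-back of a density under a homeomorphism with controlled metric
distortion. -/
lemma exists_discretization (f : ↥Sphere2 ≃ₜ ↥Sphere2) {K : ℝ} (hK : 1 ≤ K)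
    {ρ : ↥Sphere2 → ℝ≥0∞} (hρ : Measurable ρ)
    (hfin : ∫⁻ x, ρ x ^ 2 ∂sphereMeasure < ⊤) :
    ∃ M : ℝ≥0∞, M ≠ ⊤ ∧ ∀ j : ℕ, ∃ (t : Finset ↥Sphere2) (L R : ↥Sphere2 → NNReal),
      (∀ x ∈ distortionSet f K j, ∃ i ∈ t, dist x i ≤ netScale j) ∧
      (∀ i y, dist i y ≤ netScale j → dist (f i) (f y) ≤ L i) ∧
      (∀ i, ∀ m : NNReal, m ≤ j → (∀ y, dist i y ≤ netScale j → (m : ℝ≥0∞) ≤ ρ (f y)) →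
        m ≤ R i) ∧
      ∫⁻ x, (ballDensity t (netScale j) (fun i => L i * R i / netScale j) x : ℝ≥0∞) ^ 2
        ∂sphereMeasure ≤ M := by
  obtain ⟨c, hc0, hct, hc⟩ := sphereMeasure_ball_ge
  obtain ⟨C, hCt, hC⟩ := sphereMeasure_ball_le
  obtain ⟨N, hN⟩ := exists_card_filter_dist_le
  have hK0 : 0 < K := by linarith
  refine ⟨N * (4 * C * (ENNReal.ofReal K ^ 2 / c) * (N * ∫⁻ x, ρ x ^ 2 ∂sphereMeasure)), ?_,
    fun j => ?_⟩
  · refine ENNReal.mul_ne_top (by simp) (ENNReal.mul_ne_top (ENNReal.mul_ne_top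
      (ENNReal.mul_ne_top (by simp) hCt) (ENNReal.div_ne_top (by simp) hc0))
      (ENNReal.mul_ne_top (by simp) hfin.ne))
  set ε := netScale j
  have hε0 : (0 : ℝ) < ε := netScale_pos j
  have hε1 : (ε : ℝ) ≤ 1 / 5 := netScale_le j
  obtain ⟨t, htF, hsep, hcov⟩ := exists_finset_separated_net (distortionSet f K j) hε0
  have hNt := hN ε hε0 (by linarith) t hsep
  choose L hL hLat using fun x => exists_image_radius f.continuous x hε0.le
  let R' : ↥Sphere2 → ℝ≥0∞ := fun i => min (j : ℝ≥0∞) (⨅ (y) (_ : dist i y ≤ ε), ρ (f y))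
  have hR't : ∀ i, R' i ≠ ⊤ := fun i => ne_top_of_le_ne_top (by simp) (min_le_left _ _)
  have hRcoe : ∀ i, ((R' i).toNNReal : ℝ≥0∞) = R' i := fun i => ENNReal.coe_toNNReal (hR't i)
  refine ⟨t, L, fun i => (R' i).toNNReal, hcov, hL, fun i m hm h => ?_, ?_⟩
  · rw [← ENNReal.coe_le_coe, hRcoe]
    exact le_min (by exact_mod_cast hm) (le_iInf₂ h)
  refine (lintegral_sq_ballDensity_le _ hNt).trans (mul_le_mul_right ?_ _)
  refine le_trans ?_ (mul_le_mul_right (sum_setLIntegral_image_ball_le f hρ hNt) _)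
  rw [Finset.mul_sum]
  refine Finset.sum_le_sum fun i hi => ?_
  have hLm : (L i : ℝ≥0∞) ^ 2 ≤ ENNReal.ofReal K ^ 2 / c * sphereMeasure (f '' ball i ε) := by
    rcases eq_or_ne (L i) 0 with h0 | h0
    · simp [h0]
    have hL0 : (0 : ℝ) < L i := by exact_mod_cast pos_iff_ne_zero.2 h0
    obtain ⟨y, hy, hyl⟩ := hLat i
    have hL2 : (L i : ℝ) ≤ 2 := hyl ▸ dist_sphere2_le _ _
    have h1 := (hc (f i) (L i / K) (by positivity)
      (((div_le_self hL0.le hK)).trans hL2)).trans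
      (measure_mono (ball_subset_image_ball f (htF i hi) hK0 hε0 (netScale_lt j) hy hyl))
    have h2 : (L i : ℝ≥0∞) = ENNReal.ofReal K * ENNReal.ofReal (L i / K) := by
      rw [← ENNReal.ofReal_mul hK0.le, mul_div_cancel₀ _ hK0.ne', ENNReal.ofReal_coe_nnreal]
    rw [h2, mul_pow, ENNReal.div_eq_inv_mul, mul_comm c⁻¹, mul_assoc]
    refine mul_le_mul_right ?_ _
    rwa [← ENNReal.div_eq_inv_mul, ENNReal.le_div_iff_mul_le (Or.inl hc0) (Or.inl hct), mul_comm]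
  have hball := hC i (2 * ε) (by positivity) (by linarith)
  have hRρ : R' i ^ 2 * sphereMeasure (f '' ball i ε) ≤
      ∫⁻ x in f '' ball i ε, ρ x ^ 2 ∂sphereMeasure := by
    rw [← setLIntegral_const]
    refine setLIntegral_mono (hρ.pow_const 2) ?_
    rintro _ ⟨y, hy, rfl⟩
    refine pow_le_pow_left' ((min_le_right _ _).trans (iInf₂_le y ?_)) 2
    rw [mem_ball'] at hy
    exact hy.le
  have hεc : ENNReal.ofReal (2 * ε) ^ 2 = 4 * (ε : ℝ≥0∞) ^ 2 := by
    rw [ENNReal.ofReal_mul (by norm_num), mul_pow, ENNReal.ofReal_coe_nnreal]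
    norm_num
  have hε0' : (ε : ℝ≥0∞) ≠ 0 := by simpa using (netScale_pos j).ne'
  have ha : (((L i * (R' i).toNNReal / ε : NNReal)) : ℝ≥0∞) ^ 2 * (ε : ℝ≥0∞) ^ 2 =
      (L i : ℝ≥0∞) ^ 2 * R' i ^ 2 := by
    rw [← mul_pow, ← mul_pow, ENNReal.coe_div (netScale_pos j).ne', ENNReal.coe_mul, hRcoe,
      ENNReal.div_mul_cancel hε0' (by simp)]
  calc _ ≤ (((L i * (R' i).toNNReal / ε : NNReal)) : ℝ≥0∞) ^ 2 * (C * (4 * (ε : ℝ≥0∞) ^ 2)) := by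
        rw [← hεc]
        exact mul_le_mul_right hball _
    _ = 4 * C * ((L i : ℝ≥0∞) ^ 2 * R' i ^ 2) := by
        rw [← ha]
        ring
    _ ≤ 4 * C * (ENNReal.ofReal K ^ 2 / c * sphereMeasure (f '' ball i ε) * R' i ^ 2) := by
        gcongr
    _ = 4 * C * (ENNReal.ofReal K ^ 2 / c) * (R' i ^ 2 * sphereMeasure (f '' ball i ε)) := by
        ring
    _ ≤ _ := by gcongr

end Quasiconformal

section CurveEstimates

/-- A rectifiable curve of length at least `ε` that comes `ε`-close to `i` spends length at least
`ε` in the ball of radius `2 ε` about `i`. -/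
lemma coe_le_arcIntegralOn_indicator_ball {γ : ℝ → ↥Sphere2} {s t t₀ : ℝ} {ε : NNReal}
    {i : ↥Sphere2} (h : eVariationOn γ (Icc s t) ≠ ⊤) (hγ : ContinuousOn γ (Icc s t))
    (ht₀ : t₀ ∈ Icc s t) (hi : dist (γ t₀) i ≤ ε) (hε : (ε : ℝ) ≤ arcLen γ s t) :
    (ε : ℝ≥0∞) ≤ arcIntegralOn ((ball i (2 * ε)).indicator fun _ => 1) γ s t := by
  have hst : s ≤ t := ht₀.1.trans ht₀.2
  have hadd := arcLen_add h ht₀.1 ht₀.2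
  have h0 := arcLen_nonneg γ s t₀
  have h1 := arcLen_nonneg γ t₀ t
  have hε0 : (0 : ℝ) ≤ ε := ε.2
  obtain ⟨c, hc0, hcl, hc⟩ : ∃ c : ℝ, 0 ≤ c ∧ c + ε ≤ arcLen γ s t ∧
      ∀ u ∈ Ioo c (c + ε), |u - arcLen γ s t₀| < ε := by
    rcases le_total (ε : ℝ) (arcLen γ s t₀) with hle | hle
    · refine ⟨arcLen γ s t₀ - ε, by linarith, by linarith, fun u hu => ?_⟩
      rw [abs_lt]
      constructor <;> linarith [hu.1, hu.2]
    · refine ⟨0, le_rfl, by linarith, fun u hu => ?_⟩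
      rw [abs_lt]
      constructor <;> linarith [hu.1, hu.2]
  rw [arcIntegralOn_eq]
  calc (ε : ℝ≥0∞) = ∫⁻ _ in Ioo c (c + ε), 1 := by simp
    _ ≤ ∫⁻ u in Ioo c (c + ε),
        (ball i (2 * ε)).indicator (fun _ => (1 : ℝ≥0∞)) (γ (arcTime γ s t u)) := by
        refine setLIntegral_mono' measurableSet_Ioo fun u hu => ?_
        rw [indicator_of_mem]
        rw [mem_ball]
        have := dist_arcTime_le h hst (hu.2.le.trans hcl) hγ ht₀
        have := hc u hu
        linarith [dist_triangle (γ (arcTime γ s t u)) (γ t₀) i]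
    _ ≤ _ := lintegral_mono_set
        (Ioo_subset_Ico_self.trans (Ico_subset_Ico hc0 hcl))

lemma mul_volume_image_dist_le {f : ↥Sphere2 → ↥Sphere2} {γ : ℝ → ↥Sphere2} {s t : ℝ} {ε : NNReal}
    (hε0 : 0 < ε) {T : Finset ↥Sphere2} {L R : ↥Sphere2 → NNReal} {m : NNReal} {A : Set ↥Sphere2}
    (p : ↥Sphere2) (h : eVariationOn γ (Icc s t) ≠ ⊤) (hγ : ContinuousOn γ (Icc s t))
    (hε : (ε : ℝ) ≤ arcLen γ s t) (hA : A ⊆ γ '' Icc s t)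
    (hcov : ∀ x ∈ A, ∃ i ∈ T, dist x i ≤ ε) (hL : ∀ i y, dist i y ≤ ε → dist (f i) (f y) ≤ L i)
    (hR : ∀ i, (∃ x ∈ A, dist x i ≤ ε) → m ≤ R i) :
    (m : ℝ≥0∞) * volume ((fun x => dist (f x) p) '' A) ≤
      2 * arcIntegralOn (fun x => (ballDensity T ε (fun i => L i * R i / ε) x : ℝ≥0∞)) γ s t := by
  classical
  set B := T.filter fun i => ∃ x ∈ A, dist x i ≤ ε with hB
  have hcover : (fun x => dist (f x) p) '' A ⊆
      ⋃ i ∈ B, Icc (dist (f i) p - L i) (dist (f i) p + L i) := by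
    rintro _ ⟨x, hx, rfl⟩
    obtain ⟨i, hiT, hi⟩ := hcov x hx
    have h1 := hL i x (by rwa [dist_comm])
    have h2 := abs_dist_sub_le (f i) (f x) p
    rw [abs_le] at h2
    refine mem_biUnion (Finset.mem_coe.2 (Finset.mem_filter.2 ⟨hiT, x, hx, hi⟩)) ?_
    constructor <;> dsimp only <;> linarith
  have hvol : volume ((fun x => dist (f x) p) '' A) ≤ ∑ i ∈ B, 2 * (L i : ℝ≥0∞) := by
    refine (measure_mono hcover).trans ((measure_biUnion_finset_le _ _).trans ?_)
    refine Finset.sum_le_sum fun i _ => ?_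
    rw [Real.volume_Icc, show dist (f i) p + L i - (dist (f i) p - L i) = 2 * (L i : ℝ) by ring,
      ENNReal.ofReal_mul (by norm_num), ENNReal.ofReal_coe_nnreal]
    norm_num
  have hind : ∀ x, ∑ i ∈ B, ((L i * R i / ε : NNReal) : ℝ≥0∞) *
      (ball i (2 * ε)).indicator (fun _ => (1 : ℝ≥0∞)) x ≤
        (ballDensity T ε (fun i => L i * R i / ε) x : ℝ≥0∞) := by
    intro x
    rw [ballDensity, ENNReal.ofNNReal_finsetSum]
    refine (Finset.sum_le_sum_of_subset (Finset.filter_subset _ T)).trans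
      (Finset.sum_le_sum fun i _ => ?_)
    by_cases hx : x ∈ ball i (2 * ε) <;> simp [hx]
  calc (m : ℝ≥0∞) * volume ((fun x => dist (f x) p) '' A)
      ≤ m * ∑ i ∈ B, 2 * (L i : ℝ≥0∞) := by gcongr
    _ = 2 * ∑ i ∈ B, (m * L i : ℝ≥0∞) := by
        simp only [Finset.mul_sum]
        exact Finset.sum_congr rfl fun i _ => by ring
    _ ≤ 2 * ∑ i ∈ B, ((L i * R i / ε : NNReal) : ℝ≥0∞) *
          arcIntegralOn ((ball i (2 * ε)).indicator fun _ => 1) γ s t := by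
        refine mul_le_mul_right (Finset.sum_le_sum fun i hi => ?_) _
        obtain ⟨x, hx, hxi⟩ := (Finset.mem_filter.1 hi).2
        obtain ⟨t₀, ht₀, rfl⟩ := hA hx
        refine le_trans ?_
          (mul_le_mul_right (coe_le_arcIntegralOn_indicator_ball h hγ ht₀ hxi hε) _)
        rw [← ENNReal.coe_mul, ← ENNReal.coe_mul, ENNReal.coe_le_coe,
          div_mul_cancel₀ _ hε0.ne', mul_comm]
        exact mul_le_mul_right (hR i ⟨_, hx, hxi⟩) _
    _ ≤ _ := by
        gcongr
        exact (sum_mul_arcIntegralOn_le _ _ _ _ _ _).trans (arcIntegralOn_mono hind _ _ _)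

lemma ENNReal.liminf_add_liminf_le (u v : ℕ → ℝ≥0∞) :
    liminf u atTop + liminf v atTop ≤ liminf (fun n => u n + v n) atTop := by
  have hmono : ∀ w : ℕ → ℝ≥0∞, Monotone fun n => ⨅ i ≥ n, w i := fun w m n hmn =>
    le_iInf₂ fun i hi => iInf₂_le i (hmn.trans hi)
  simp only [liminf_eq_iSup_iInf_of_nat]
  rw [ENNReal.iSup_add_iSup_of_monotone (hmono u) (hmono v)]
  exact iSup_mono fun n => le_iInf₂ fun i hi => add_le_add (iInf₂_le i hi) (iInf₂_le i hi)

lemma tendsto_netScale : Tendsto (fun j => (netScale j : ℝ)) atTop (𝓝 0) :=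
  squeeze_zero (fun j => (netScale j).2) (fun j => (netScale_lt j).le)
    tendsto_one_div_add_atTop_nhds_zero_nat

lemma mul_edist_le_liminf {f : ↥Sphere2 ≃ₜ ↥Sphere2} {K : ℝ}
    (hK : ⋃ j, distortionSet f K j = univ) {ρ : ↥Sphere2 → ℝ≥0∞} (hρ : LowerSemicontinuous ρ)
    {T : ℕ → Finset ↥Sphere2} {L R : ℕ → ↥Sphere2 → NNReal}
    (hT : ∀ j, ∀ x ∈ distortionSet f K j, ∃ i ∈ T j, dist x i ≤ netScale j)
    (hL : ∀ j i y, dist i y ≤ netScale j → dist (f i) (f y) ≤ L j i)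
    (hR : ∀ (j : ℕ) i, ∀ m : NNReal, m ≤ (j : ℕ) →
      (∀ y, dist i y ≤ netScale j → (m : ℝ≥0∞) ≤ ρ (f y)) → m ≤ R j i)
    {γ : ℝ → ↥Sphere2} {s t : ℝ} (hst : s ≤ t) (h : eVariationOn γ (Icc s t) ≠ ⊤)
    (hγ : ContinuousOn γ (Icc s t)) {m : ℝ≥0∞} (hm : ∀ r ∈ Icc s t, m ≤ ρ (f (γ r))) :
    m * edist (f (γ s)) (f (γ t)) ≤ liminf (fun j => 2 * arcIntegralOn (fun x =>
      (ballDensity (T j) (netScale j) (fun i => L j i * R j i / netScale j) x : ℝ≥0∞)) γ s t)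
      atTop := by
  rcases eq_or_ne (γ s) (γ t) with heq | hne
  · simp [heq]
  refine ENNReal.mul_le_of_forall_lt fun m₀ hm₀ b hb => ?_
  obtain ⟨m', hmm', hm'⟩ := ENNReal.lt_iff_exists_nnreal_btwn.1 hm₀
  refine (mul_le_mul_left hmm'.le b).trans ?_
  set φ : ↥Sphere2 → ℝ := fun x => dist (f x) (f (γ s)) with hφ
  have hφc : Continuous φ := f.continuous.dist continuous_const
  have hlen : 0 < arcLen γ s t := (dist_pos.2 hne).trans_le (dist_le_arcLen h hst)
  have hIVT : Icc 0 (dist (f (γ s)) (f (γ t))) ⊆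
      ⋃ j, φ '' (γ '' Icc s t ∩ distortionSet f K j) := by
    rw [← image_iUnion, ← inter_iUnion, hK, inter_univ, ← image_comp]
    have := intermediate_value_Icc hst (hφc.comp_continuousOn hγ)
    simpa [hφ, dist_comm] using this
  have hmono : Monotone fun j => φ '' (γ '' Icc s t ∩ distortionSet f K j) := fun i j hij =>
    image_mono (inter_subset_inter_right _ (monotone_distortionSet f K hij))
  have hvol : b < ⨆ j, volume (φ '' (γ '' Icc s t ∩ distortionSet f K j)) := by
    rw [← hmono.measure_iUnion]
    refine hb.trans_le (le_trans ?_ (measure_mono hIVT))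
    rw [Real.volume_Icc, sub_zero, edist_dist]
  obtain ⟨J, hJ⟩ := lt_iSup_iff.1 hvol
  have hU : IsOpen ((fun y => ρ (f y)) ⁻¹' Ioi (m' : ℝ≥0∞)) :=
    (hρ.isOpen_preimage _).preimage f.continuous
  obtain ⟨δ, hδ0, hδ⟩ := (isCompact_Icc.image_of_continuousOn hγ).exists_cthickening_subset_open hU
    (by rintro _ ⟨r, hr, rfl⟩; exact hm'.trans_le (hm r hr))
  have hev : ∀ᶠ j : ℕ in atTop, (netScale j : ℝ) ≤ min (δ / 2) (arcLen γ s t) :=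
    (tendsto_netScale.eventually (ge_mem_nhds (by positivity : (0 : ℝ) < min (δ / 2) _)))
  refine le_liminf_of_le (by isBoundedDefault) ?_
  filter_upwards [hev, eventually_ge_atTop J, eventually_ge_atTop ⌈m'⌉₊] with j hj hjJ hjm
  refine (mul_le_mul_right (hJ.le.trans (measure_mono (hmono hjJ))) _).trans
    (mul_volume_image_dist_le (netScale_pos j) _ h hγ (hj.trans (min_le_right _ _))
      inter_subset_left (fun x hx => hT j x hx.2) (hL j) ?_)
  rintro i ⟨x, hx, hxi⟩
  refine hR j i m' ((Nat.le_ceil m').trans (by exact_mod_cast hjm)) fun y hy => ?_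
  refine (hδ (mem_cthickening_of_dist_le y x δ _ hx.1 ?_) : (m' : ℝ≥0∞) < ρ (f y)).le
  have := hj.trans (min_le_left _ _)
  rw [dist_comm]
  linarith [dist_triangle x i y]

lemma sum_le_of_superadditive {Λ : ℝ → ℝ → ℝ≥0∞} {a b : ℝ}
    (hΛ : ∀ s t r, a ≤ s → s ≤ t → t ≤ r → r ≤ b → Λ s t + Λ t r ≤ Λ s r) {s t : ℝ} (has : a ≤ s)
    (htb : t ≤ b) {u : ℕ → ℝ} (hu : Monotone u) (n : ℕ) (hmem : ∀ i ≤ n, u i ∈ Icc s t) :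
    ∑ i ∈ Finset.range n, Λ (u i) (u (i + 1)) ≤ Λ s t := by
  have key : ∀ m ≤ n, ∑ i ∈ Finset.range m, Λ (u i) (u (i + 1)) ≤ Λ s (u m) := by
    intro m
    induction m with
    | zero => simp
    | succ m ih =>
      intro hm
      have h1 := hmem m (by omega)
      have h2 := hmem (m + 1) hm
      rw [Finset.sum_range_succ]
      exact (add_le_add_left (ih (by omega)) _).trans
        (hΛ _ _ _ has h1.1 (hu m.le_succ) (h2.2.trans htb))
  have h1 := hmem n le_rfl
  exact (key n le_rfl).trans (le_self_add.trans (hΛ _ _ _ has h1.1 h1.2 htb))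

lemma mul_eVariationOn_le_of_superadditive {β : ℝ → ↥Sphere2} {ρ : ↥Sphere2 → ℝ≥0∞}
    {Λ : ℝ → ℝ → ℝ≥0∞} {a b : ℝ}
    (hΛ : ∀ s t r, a ≤ s → s ≤ t → t ≤ r → r ≤ b → Λ s t + Λ t r ≤ Λ s r)
    (hle : ∀ s t, a ≤ s → s ≤ t → t ≤ b → ∀ m : ℝ≥0∞, (∀ r ∈ Icc s t, m ≤ ρ (β r)) →
      m * edist (β s) (β t) ≤ Λ s t)
    {s t : ℝ} (has : a ≤ s) (htb : t ≤ b) {m : ℝ≥0∞} (hm : ∀ r ∈ Icc s t, m ≤ ρ (β r)) :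
    m * eVariationOn β (Icc s t) ≤ Λ s t := by
  rw [eVariationOn, ENNReal.mul_iSup]
  refine iSup_le fun ⟨n, u, hu, hmem⟩ => ?_
  rw [Finset.mul_sum]
  refine le_trans (Finset.sum_le_sum fun i _ => ?_)
    (sum_le_of_superadditive hΛ has htb hu n fun i _ => hmem i)
  rw [edist_comm]
  exact hle _ _ (has.trans (hmem i).1) (hu i.le_succ) ((hmem _).2.trans htb) m fun r hr =>
    hm r ⟨(hmem i).1.trans hr.1, hr.2.trans (hmem _).2⟩

lemma exists_le_lt_succ {v : ℕ → ℝ} {u : ℝ} {n : ℕ} (h0 : v 0 ≤ u) (hn : u < v n) :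
    ∃ k < n, v k ≤ u ∧ u < v (k + 1) := by
  induction n with
  | zero => exact absurd hn h0.not_gt
  | succ n ih =>
    rcases le_or_gt (v n) u with h | h
    · exact ⟨n, n.lt_succ_self, h, hn⟩
    · obtain ⟨k, hk, h1⟩ := ih h
      exact ⟨k, hk.trans n.lt_succ_self, h1⟩

/-- A superadditive interval function that dominates `ρ` times length on intervals where `ρ` is
bounded below dominates the arclength integral of the lower semicontinuous density `ρ`. -/
lemma arcIntegralOn_le_of_superadditive {β : ℝ → ↥Sphere2} {ρ : ↥Sphere2 → ℝ≥0∞}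
    {Λ : ℝ → ℝ → ℝ≥0∞} {a b : ℝ} (hρ : LowerSemicontinuous ρ) (hab : a ≤ b)
    (h : eVariationOn β (Icc a b) ≠ ⊤) (hβ : ContinuousOn β (Icc a b))
    (hΛ : ∀ s t r, a ≤ s → s ≤ t → t ≤ r → r ≤ b → Λ s t + Λ t r ≤ Λ s r)
    (hle : ∀ s t, a ≤ s → s ≤ t → t ≤ b → ∀ m : ℝ≥0∞, (∀ r ∈ Icc s t, m ≤ ρ (β r)) →
      m * edist (β s) (β t) ≤ Λ s t) :
    arcIntegralOn ρ β a b ≤ Λ a b := by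
  let p : ℕ → ℕ → ℝ := fun n k => a + k * ((b - a) / (n + 1))
  have hstep : ∀ n : ℕ, 0 ≤ (b - a) / ((n : ℝ) + 1) := fun n =>
    div_nonneg (sub_nonneg.2 hab) (by positivity)
  have hp0 : ∀ n, p n 0 = a := fun n => by simp [p]
  have hplast : ∀ n, p n (n + 1) = b := fun n => by
    have : ((n : ℝ) + 1) ≠ 0 := by positivity
    simp only [p]
    push_cast
    field_simp
    ring
  have hpmono : ∀ n, Monotone (p n) := fun n i j hij => by
    have : (i : ℝ) ≤ j := by exact_mod_cast hij
    simp only [p]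
    gcongr
  have hpmem : ∀ n, ∀ k ≤ n + 1, p n k ∈ Icc a b := fun n k hk =>
    ⟨hp0 n ▸ hpmono n (Nat.zero_le k), hplast n ▸ hpmono n hk⟩
  have hpsucc : ∀ n k, p n (k + 1) = p n k + (b - a) / (n + 1) := fun n k => by
    simp only [p]
    push_cast
    ring
  let m : ℕ → ℕ → ℝ≥0∞ := fun n k => ⨅ r ∈ Icc (p n k) (p n (k + 1)), ρ (β r)
  let H : ℕ → ℝ → ℝ≥0∞ := fun n u => ∑ k ∈ Finset.range (n + 1),
    (Ico (arcLen β a (p n k)) (arcLen β a (p n (k + 1)))).indicator (fun _ => m n k) u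
  have hHm : ∀ n, Measurable (H n) := fun n =>
    Finset.measurable_sum _ fun _ _ => measurable_const.indicator measurableSet_Ico
  have hHint : ∀ n, ∫⁻ u, H n u ≤ Λ a b := by
    intro n
    simp only [H]
    rw [lintegral_finsetSum _ fun _ _ => measurable_const.indicator measurableSet_Ico]
    refine le_trans (Finset.sum_le_sum fun k hk => ?_)
      (sum_le_of_superadditive hΛ le_rfl le_rfl (hpmono n) (n + 1) (hpmem n))
    have hk' : k < n + 1 := Finset.mem_range.1 hk
    have h1 := hpmem n k hk'.le
    have h2 := hpmem n (k + 1) hk'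
    rw [lintegral_indicator_const measurableSet_Ico, Real.volume_Ico,
      ← arcLen_add (eVariationOn_Icc_ne_top h le_rfl h2.2) h1.1 (hpmono n k.le_succ),
      add_sub_cancel_left, arcLen, ENNReal.ofReal_toReal (eVariationOn_Icc_ne_top h h1.1 h2.2)]
    exact mul_eVariationOn_le_of_superadditive hΛ hle h1.1 h2.2 fun r hr => iInf₂_le r hr
  have hlim : ∀ u ∈ Ico 0 (arcLen β a b),
      ρ (β (arcTime β a b u)) ≤ liminf (fun n => H n u) atTop := by
    intro u hu
    refine le_of_forall_lt fun c hc => ?_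
    obtain ⟨c', hcc', hc'⟩ := exists_between hc
    refine hcc'.trans_le (le_liminf_of_le (by isBoundedDefault) ?_)
    obtain ⟨δ, hδ0, hδ⟩ := Metric.isOpen_iff.1 (hρ.isOpen_preimage c') _ hc'
    obtain ⟨η, hη0, hη⟩ := Metric.uniformContinuousOn_iff.1
      (isCompact_Icc.uniformContinuousOn_of_continuous hβ) δ hδ0
    have htend : Tendsto (fun n : ℕ => (b - a) / ((n : ℝ) + 1)) atTop (𝓝 0) := by
      simpa [div_eq_mul_inv] using
        (tendsto_one_div_add_atTop_nhds_zero_nat (𝕜 := ℝ)).const_mul (b - a)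
    filter_upwards [htend.eventually (gt_mem_nhds hη0)] with n hn
    obtain ⟨k, hk, hku, huk⟩ := exists_le_lt_succ (v := fun k => arcLen β a (p n k)) (u := u)
      (n := n + 1) (by simpa [hp0, arcLen_self] using hu.1) (by simpa [hplast] using hu.2)
    have h1 := hpmem n k hk.le
    have h2 := hpmem n (k + 1) hk
    obtain ⟨t₀, ht₀, heq⟩ : ∃ t₀ ∈ Icc (p n k) (p n (k + 1)), β (arcTime β a b u) = β t₀ := by
      rcases le_or_gt (p n k) (arcTime β a b u) with hge | hlt
      · exact ⟨_, ⟨hge, arcTime_le_of_le_arcLen h h2 huk.le⟩, rfl⟩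
      · refine ⟨_, left_mem_Icc.2 (hpmono n k.le_succ), dist_le_zero.1 ?_⟩
        have h3 := le_arcLen_of_arcTime_lt h hab hu.2.le h1 hlt
        have h4 := dist_arcTime_le h hab hu.2.le hβ h1
        rwa [le_antisymm h3 hku, sub_self, abs_zero, ← le_antisymm h3 hku] at h4
    have hmk : c' ≤ m n k := by
      refine le_iInf₂ fun r hr => (hδ ?_ : c' < ρ (β r)).le
      rw [heq, mem_ball]
      refine hη r ⟨h1.1.trans hr.1, hr.2.trans h2.2⟩ t₀ ⟨h1.1.trans ht₀.1, ht₀.2.trans h2.2⟩ ?_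
      rw [Real.dist_eq, abs_lt]
      rw [hpsucc] at hr ht₀
      constructor <;> linarith [hr.1, hr.2, ht₀.1, ht₀.2]
    refine hmk.trans (le_trans ?_ (Finset.single_le_sum (fun _ _ => zero_le)
      (Finset.mem_range.2 hk)))
    exact (indicator_of_mem (s := Ico _ _) ⟨hku, huk⟩ fun _ => m n k).ge
  rw [arcIntegralOn_eq]
  calc _ ≤ ∫⁻ u in Ico 0 (arcLen β a b), liminf (fun n => H n u) atTop :=
        setLIntegral_mono' measurableSet_Ico hlim
    _ ≤ liminf (fun n => ∫⁻ u in Ico 0 (arcLen β a b), H n u) atTop := lintegral_liminf_le hHm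
    _ ≤ liminf (fun _ : ℕ => Λ a b) atTop := liminf_le_liminf
        (Eventually.of_forall fun n => (setLIntegral_le_lintegral _ _).trans (hHint n))
    _ = Λ a b := liminf_const _

/-- An `L²` density is dominated by a lower semicontinuous `L²` density that is at least `1`. -/
lemma exists_lowerSemicontinuous_ge {ρ : ↥Sphere2 → ℝ≥0∞} (hρ : Measurable ρ)
    (hfin : ∫⁻ x, ρ x ^ 2 ∂sphereMeasure < ⊤) :
    ∃ ρ' : ↥Sphere2 → ℝ≥0∞, LowerSemicontinuous ρ' ∧ (∀ x, ρ x ≤ ρ' x) ∧ (∀ x, 1 ≤ ρ' x) ∧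
      ∫⁻ x, ρ' x ^ 2 ∂sphereMeasure < ⊤ := by
  obtain ⟨g, hg, hlsc, hbound⟩ := exists_le_lowerSemicontinuous_lintegral_ge sphereMeasure
    (fun x => ρ x ^ 2) (hρ.pow_const 2) one_ne_zero
  have hsq : ∀ y : ℝ≥0∞, (y ^ (1 / 2 : ℝ)) ^ 2 = y := fun y => by
    rw [← ENNReal.rpow_natCast, ← ENNReal.rpow_mul]
    norm_num
  have hlsc' : LowerSemicontinuous fun x => g x ^ (1 / 2 : ℝ) :=
    (ENNReal.continuous_rpow_const (y := 1 / 2)).comp_lowerSemicontinuous hlsc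
      (ENNReal.monotone_rpow_of_nonneg (by norm_num))
  refine ⟨fun x => g x ^ (1 / 2 : ℝ) + 1, hlsc'.add lowerSemicontinuous_const, fun x => ?_,
    fun x => le_add_self, ?_⟩
  · refine le_add_right ?_
    have := ENNReal.rpow_le_rpow (hg x) (by norm_num : (0 : ℝ) ≤ 1 / 2)
    rwa [← ENNReal.rpow_natCast, ← ENNReal.rpow_mul, Nat.cast_ofNat, mul_one_div_cancel two_ne_zero,
      ENNReal.rpow_one] at this
  · refine lintegral_sq_add_lt_top hlsc'.measurable ?_ ?_
    · simp only [hsq]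
      exact hbound.trans_lt (ENNReal.add_lt_top.2 ⟨hfin, ENNReal.one_lt_top⟩)
    · simp [measure_lt_top]

/-- Quasiconformal homeomorphisms pull back path families of conformal modulus zero to path
families of conformal modulus zero. -/
theorem conformalModulus_preimage_map_eq_zero {Ψ : ↥Sphere2 ≃ₜ ↥Sphere2}
    (hQC : IsQuasiconformalOn Ψ univ univ) {Γ₀ : Set SpherePath} (h0 : conformalModulus Γ₀ = 0) :
    conformalModulus {γ : SpherePath | γ.map Ψ ∈ Γ₀} = 0 := by
  obtain ⟨ρ₀, hρ₀m, hρ₀fin, hρ₀⟩ := (conformalModulus_eq_zero_iff Γ₀).1 h0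
  obtain ⟨ρ, hlsc, hge, hge1, hfin⟩ := exists_lowerSemicontinuous_ge hρ₀m hρ₀fin
  obtain ⟨K, hK1, hK⟩ := exists_iUnion_distortionSet hQC
  obtain ⟨M, hM, hdisc⟩ := exists_discretization Ψ hK1 hlsc.measurable hfin
  choose T L R hT hL hR hbound using hdisc
  let g : ℕ → ↥Sphere2 → NNReal := fun j =>
    ballDensity (T j) (netScale j) fun i => L j i * R j i / netScale j
  obtain ⟨G, hGm, hGfin, hG⟩ := exists_lintegral_sq_dominating sphereMeasure g
    (fun j => measurable_ballDensity _ _ _) M hM hbound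
  refine (conformalModulus_eq_zero_iff _).2 ⟨G, hGm, hGfin, fun γ hγ hrect => ?_⟩
  let Λ : ℝ → ℝ → ℝ≥0∞ := fun s t =>
    liminf (fun j => 2 * arcIntegralOn (fun x => (g j x : ℝ≥0∞)) γ.toFun s t) atTop
  have hΛ : ∀ {a b : ℝ}, Icc a b ⊆ γ.I →
      ∀ s t r, a ≤ s → s ≤ t → t ≤ r → r ≤ b → Λ s t + Λ t r ≤ Λ s r := by
    intro a b hI s t r has hst htr hrb
    have hfin' : eVariationOn γ.toFun (Icc s r) ≠ ⊤ :=
      (hrect s r ((Icc_subset_Icc has hrb).trans hI)).ne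
    refine (ENNReal.liminf_add_liminf_le _ _).trans_eq ?_
    simp only [← mul_add, arcIntegralOn_add _ hfin' hst htr, Λ]
  have hle : ∀ {a b : ℝ}, Icc a b ⊆ γ.I → ∀ s t, a ≤ s → s ≤ t → t ≤ b → ∀ m : ℝ≥0∞,
      (∀ r ∈ Icc s t, m ≤ ρ ((γ.map Ψ).toFun r)) →
        m * edist ((γ.map Ψ).toFun s) ((γ.map Ψ).toFun t) ≤ Λ s t := by
    intro a b hI s t has hst htb m hm
    have hI' := (Icc_subset_Icc has htb).trans hI
    exact mul_edist_le_liminf hK hlsc hT hL hR hst (hrect s t hI').ne (γ.cont.mono hI') hm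
  have hlarge : ∀ r : NNReal, ∃ a b, Icc a b ⊆ γ.I ∧ (r : ℝ≥0∞) < Λ a b := by
    intro r
    by_cases hrect' : (γ.map Ψ).LocRectifiable
    · have htop : (r : ℝ≥0∞) < (γ.map Ψ).lineIntegral ρ :=
        ENNReal.coe_lt_top.trans_le ((hρ₀ _ hγ hrect').ge.trans (lineIntegral_mono hge _))
      obtain ⟨a, b, hab, hI, hlt⟩ := exists_lt_arcIntegralOn htop
      exact ⟨a, b, hI, hlt.trans_le (arcIntegralOn_le_of_superadditive hlsc hab
        (hrect' a b hI).ne ((γ.map Ψ).cont.mono hI) (hΛ hI) (hle hI))⟩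
    · simp only [SpherePath.LocRectifiable, not_forall, not_lt, top_le_iff] at hrect'
      obtain ⟨a, b, hI, hvar⟩ := hrect'
      refine ⟨a, b, hI, ?_⟩
      have := mul_eVariationOn_le_of_superadditive (hΛ hI) (hle hI) le_rfl le_rfl (m := 1)
        fun r _ => hge1 _
      rw [hvar, one_mul, top_le_iff] at this
      rw [this]
      exact ENNReal.coe_lt_top
  have h2 : 2 * γ.lineIntegral G = ⊤ := by
    refine ENNReal.eq_top_of_forall_nnreal_le fun r => ?_
    obtain ⟨a, b, hI, hlt⟩ := hlarge r
    obtain ⟨N, hN⟩ := eventually_atTop.1 (eventually_lt_of_lt_liminf hlt)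
    obtain ⟨s, w, hs, hw, hwG⟩ := hG N
    calc (r : ℝ≥0∞) = ∑ j ∈ s, (w j : ℝ≥0∞) * r := by
          rw [← Finset.sum_mul, ← ENNReal.ofNNReal_finsetSum, hw, ENNReal.coe_one, one_mul]
      _ ≤ ∑ j ∈ s, (w j : ℝ≥0∞) *
          (2 * arcIntegralOn (fun x => (g j x : ℝ≥0∞)) γ.toFun a b) :=
          Finset.sum_le_sum fun j hj => mul_le_mul_right (hN j (hs j hj)).le _
      _ = 2 * ∑ j ∈ s, (w j : ℝ≥0∞) * arcIntegralOn (fun x => (g j x : ℝ≥0∞)) γ.toFun a b := by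
          rw [Finset.mul_sum]
          exact Finset.sum_congr rfl fun j _ => by ring
      _ ≤ 2 * γ.lineIntegral G := by
          gcongr
          exact (sum_mul_arcIntegralOn_le _ _ _ _ _ _).trans
            ((arcIntegralOn_mono hwG _ _ _).trans (arcIntegralOn_le_lineIntegral hI _))
  simpa [ENNReal.mul_eq_top] using h2

end CurveEstimates

section CycleSums

open Equiv.Perm

/-- The sum of `r` over a set of representatives of the cycles of the permutation `σ`. -/
noncomputable def cycleSum {P : Type*} (σ : Equiv.Perm P) (r : P → ℝ≥0∞) : ℝ≥0∞ :=
  ∑' q : Quotient (SameCycle.setoid σ), r q.out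

lemma apply_zpow_of_invariant {P : Type*} {σ : Equiv.Perm P} {β : Type*} {r : P → β}
    (hr : ∀ x, r (σ x) = r x) (n : ℤ) (x : P) : r ((σ ^ n) x) = r x := by
  induction n with
  | zero => simp
  | succ n ih => rw [add_comm, zpow_add, zpow_one, mul_apply, hr, ih]
  | pred n ih =>
    rw [← hr ((σ ^ _) x), ← mul_apply, ← zpow_one_add, add_sub_cancel, ih]

lemma apply_out_of_invariant {P : Type*} {σ : Equiv.Perm P} {β : Type*} {r : P → β}
    (hr : ∀ x, r (σ x) = r x) (x : P) : r (Quotient.mk (SameCycle.setoid σ) x).out = r x := by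
  obtain ⟨n, hn⟩ := Quotient.exact (Quotient.out_eq (Quotient.mk (SameCycle.setoid σ) x))
  rw [← apply_zpow_of_invariant hr n, hn]

lemma cycleSum_pow_le {P : Type*} {σ : Equiv.Perm P} {r : P → ℝ≥0∞} (hr : ∀ x, r (σ x) = r x)
    {k : ℕ} (hk : 1 ≤ k) : cycleSum (σ ^ k) r ≤ k * cycleSum σ r := by
  let F : Quotient (SameCycle.setoid σ) × Fin k → Quotient (SameCycle.setoid (σ ^ k)) :=
    fun p => Quotient.mk _ ((σ ^ (p.2 : ℕ)) p.1.out)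
  have hF : Function.Surjective F := by
    intro q
    obtain ⟨n, hn⟩ := Quotient.exact (Quotient.out_eq (Quotient.mk (SameCycle.setoid σ) q.out))
    have hk0 : (0 : ℤ) < k := by exact_mod_cast hk
    refine ⟨(Quotient.mk _ q.out, ⟨(n % k).toNat, ?_⟩), ?_⟩
    · have := Int.emod_lt_of_pos n hk0
      omega
    have hdiv : ∀ x, ((σ ^ k) ^ (n / k)) ((σ ^ (n % k).toNat) x) = (σ ^ n) x := fun x => by
      rw [← zpow_natCast σ k, ← zpow_mul, ← zpow_natCast, ← mul_apply, ← zpow_add,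
        Int.toNat_of_nonneg (Int.emod_nonneg n hk0.ne'), Int.mul_ediv_add_emod]
    exact Eq.trans (Quotient.sound ⟨n / k, (hdiv _).trans hn⟩) q.out_eq
  have hrk : ∀ x, r ((σ ^ k) x) = r x := fun x => by
    simpa using apply_zpow_of_invariant hr k x
  refine (ENNReal.tsum_le_tsum_comp_of_surjective hF _).trans_eq ?_
  have hval : ∀ p : Quotient (SameCycle.setoid σ) × Fin k, r (F p).out = r p.1.out := fun p => by
    rw [apply_out_of_invariant hrk]
    simpa using apply_zpow_of_invariant hr (p.2 : ℕ) p.1.out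
  simp only [hval]
  rw [ENNReal.tsum_prod (f := fun (q : Quotient (SameCycle.setoid σ)) (_ : Fin k) => r q.out),
    cycleSum, ← ENNReal.tsum_mul_left]
  simp [tsum_fintype]

lemma cycleSum_indicator_le {P : Type*} {σ : Equiv.Perm P} {r : P → ℝ≥0∞} {k : ℕ}
    (hr : ∀ x, r ((σ ^ k) x) = r x) {F : Set P} (hF : ∀ x ∈ F, ∀ n : ℤ, n ≠ 0 → (σ ^ n) x ≠ x) :
    cycleSum σ (F.indicator fun x => ∑ i ∈ Finset.range k, r ((σ ^ i) x)) ≤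
      cycleSum (σ ^ k) r := by
  let F' : Set (Quotient (SameCycle.setoid σ)) := {q | q.out ∈ F}
  let f : F' × Fin k → Quotient (SameCycle.setoid (σ ^ k)) :=
    fun p => Quotient.mk _ ((σ ^ (p.2 : ℕ)) p.1.1.out)
  have hf : Function.Injective f := by
    rintro ⟨⟨q, hq⟩, i⟩ ⟨⟨q', hq'⟩, j⟩ h
    obtain ⟨n, hn⟩ := Quotient.exact h
    dsimp only at hn
    rw [← zpow_natCast σ k, ← zpow_mul, ← zpow_natCast, ← zpow_natCast, ← mul_apply,
      ← zpow_add] at hn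
    have hn' : (σ ^ (-(j : ℤ) + (k * n + i))) q.out = q'.out := by
      rw [zpow_add, mul_apply, hn, ← mul_apply, ← zpow_add]
      simp
    have hqq : q = q' := by
      rw [← q.out_eq, ← q'.out_eq]
      exact Quotient.sound ⟨_, hn'⟩
    subst hqq
    have h0 : -((j : ℕ) : ℤ) + (k * n + (i : ℕ)) = 0 := by
      by_contra hne
      exact hF _ hq _ hne hn'
    have hij : (i : ℕ) = j := by
      have h1 : ((j : ℕ) : ℤ) = (i : ℕ) + k * n := by linarith
      have h2 := congrArg (· % (k : ℤ)) h1
      simp only [Int.add_mul_emod_self_left] at h2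
      have hi := i.2
      have hj := j.2
      rw [Int.emod_eq_of_lt (by omega) (by omega), Int.emod_eq_of_lt (by omega) (by omega)] at h2
      omega
    simp [Fin.ext_iff, hij]
  refine le_trans (le_of_eq ?_) (ENNReal.tsum_comp_le_tsum_of_injective hf _)
  have hval : ∀ p : F' × Fin k, r (f p).out = r ((σ ^ (p.2 : ℕ)) p.1.1.out) := fun p =>
    apply_out_of_invariant hr _
  simp only [hval]
  rw [ENNReal.tsum_prod (f := fun (q : F') (i : Fin k) => r ((σ ^ (i : ℕ)) q.1.out)), cycleSum,
    tsum_subtype F' fun q => ∑' i : Fin k, r ((σ ^ (i : ℕ)) q.out)]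
  refine tsum_congr fun q => ?_
  by_cases hq : q.out ∈ F
  · rw [indicator_of_mem hq, indicator_of_mem (show q ∈ F' from hq), tsum_fintype,
      Finset.sum_range]
  · rw [indicator_of_notMem hq, indicator_of_notMem (show q ∉ F' from hq)]

end CycleSums

section PeripheralAction

lemma homeoPow_eq_pow {X : Type*} [TopologicalSpace X] (e : X ≃ₜ X) (n : ℕ) :
    homeoPow e n = e ^ n := by
  induction n with
  | zero => rfl
  | succ n ih => rw [pow_succ', homeoPow, ih]; rfl

lemma homeoZPow_eq_zpow {X : Type*} [TopologicalSpace X] (e : X ≃ₜ X) (n : ℤ) :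
    homeoZPow e n = e ^ n := by
  cases n with
  | ofNat n => rw [homeoZPow, homeoPow_eq_pow, Int.ofNat_eq_natCast, zpow_natCast]
  | negSucc n => rw [homeoZPow, homeoPow_eq_pow, zpow_negSucc]; rfl

lemma setImage_one {S C : Set ↥Sphere2} (hC : C ⊆ S) : setImage S 1 C = C := by
  ext x
  simp only [setImage, mem_image, mem_preimage]
  constructor
  · rintro ⟨_, ⟨y, hy, rfl⟩, rfl⟩
    exact hy
  · exact fun hx => ⟨⟨x, hC hx⟩, ⟨⟨x, hC hx⟩, hx, rfl⟩, rfl⟩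

lemma setImage_mul (S : Set ↥Sphere2) (g h : ↥S ≃ₜ ↥S) (C : Set ↥Sphere2) :
    setImage S (g * h) C = setImage S g (setImage S h C) := by
  rw [setImage, setImage, setImage, preimage_image_eq _ Subtype.val_injective, ← image_comp g h]
  rfl

lemma IsPeripheralCircle.setImage {S C : Set ↥Sphere2} (hC : IsPeripheralCircle S C)
    (g : ↥S ≃ₜ ↥S) : IsPeripheralCircle S (setImage S g C) := by
  obtain ⟨hCS, ⟨e⟩, hconn⟩ := hC
  refine ⟨?_, ⟨?_⟩, ?_⟩
  · rintro _ ⟨x, -, rfl⟩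
    exact x.2
  · have hval : ((↑) : ↥S → ↥Sphere2) '' ((↑) ⁻¹' C) = C := by
      rw [Subtype.image_preimage_coe, inter_eq_right.2 hCS]
    exact (IsEmbedding.subtypeVal.homeomorphImage _).symm.trans
      ((g.image _).symm.trans ((IsEmbedding.subtypeVal.homeomorphImage _).trans
        ((Homeomorph.setCongr hval).trans e)))
  · have hdiff : S \ _root_.setImage S g C =
        ((↑) : ↥S → ↥Sphere2) '' (g '' ((↑) ⁻¹' (S \ C))) := by
      rw [_root_.setImage, preimage_sdiff, image_sdiff g.injective,
        image_sdiff Subtype.val_injective, Subtype.coe_preimage_self, image_univ,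
        g.surjective.range_eq, image_univ, Subtype.range_coe]
    rw [hdiff]
    have hval : ((↑) : ↥S → ↥Sphere2) '' ((↑) ⁻¹' (S \ C)) = S \ C := by
      rw [Subtype.image_preimage_coe, inter_eq_right.2 sdiff_subset]
    refine ⟨?_, ?_⟩
    · obtain ⟨x, hx⟩ := hconn.1
      exact ⟨_, mem_image_of_mem _ (mem_image_of_mem _ (show (⟨x, hx.1⟩ : ↥S) ∈ _ from hx))⟩
    · have h1 : IsPreconnected (((↑) : ↥S → ↥Sphere2) ⁻¹' (S \ C)) := by
        rw [← IsInducing.subtypeVal.isPreconnected_image, hval]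
        exact hconn.2
      exact (h1.image _ g.continuous.continuousOn).image _ continuous_subtype_val.continuousOn

/-- The action of the homeomorphisms of `S` on the peripheral circles of `S`. -/
def peripheralPerm (S : Set ↥Sphere2) :
    (↥S ≃ₜ ↥S) →* Equiv.Perm {C : Set ↥Sphere2 // IsPeripheralCircle S C} where
  toFun g :=
    { toFun := fun C => ⟨setImage S g C, C.2.setImage g⟩
      invFun := fun C => ⟨setImage S g⁻¹ C, C.2.setImage g⁻¹⟩
      left_inv := fun C => Subtype.ext <| by
        dsimp only
        rw [← setImage_mul, inv_mul_cancel, setImage_one C.2.1]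
      right_inv := fun C => Subtype.ext <| by
        dsimp only
        rw [← setImage_mul, mul_inv_cancel, setImage_one C.2.1] }
  map_one' := Equiv.ext fun C => Subtype.ext (setImage_one C.2.1)
  map_mul' g h := Equiv.ext fun C => Subtype.ext (setImage_mul S g h C)

lemma setImage_homeoZPow (S : Set ↥Sphere2) (e : ↥S ≃ₜ ↥S) (n : ℤ)
    (C : {C : Set ↥Sphere2 // IsPeripheralCircle S C}) :
    setImage S (homeoZPow e n) C = (((peripheralPerm S e) ^ n) C : _) := by
  rw [← map_zpow, homeoZPow_eq_zpow]
  rfl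

lemma invariantMass_homeoCyclic_iff {S : Set ↥Sphere2} {e : ↥S ≃ₜ ↥S}
    {ρ : Set ↥Sphere2 → ℝ≥0∞} :
    InvariantMass S (homeoCyclic e) ρ ↔
      ∀ C : {C : Set ↥Sphere2 // IsPeripheralCircle S C}, ρ (peripheralPerm S e C) = ρ C := by
  constructor
  · intro h C
    have := h _ (mem_range_self 1) C C.2
    rwa [setImage_homeoZPow, zpow_one] at this
  · rintro h _ ⟨n, rfl⟩ C hC
    have := apply_zpow_of_invariant (r := fun C : {C // IsPeripheralCircle S C} => ρ C) h n ⟨C, hC⟩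
    rwa [← setImage_homeoZPow] at this

lemma groupMass_homeoCyclic {S : Set ↥Sphere2} {e : ↥S ≃ₜ ↥S} {ρ : Set ↥Sphere2 → ℝ≥0∞}
    (hρ : InvariantMass S (homeoCyclic e) ρ) :
    groupMass S (homeoCyclic e) ρ = cycleSum (peripheralPerm S e) fun C => ρ C ^ 2 := by
  set σ := peripheralPerm S e
  have hinv : ∀ C : {C : Set ↥Sphere2 // IsPeripheralCircle S C}, ρ (σ C) = ρ C :=
    invariantMass_homeoCyclic_iff.1 hρ
  have horb : ∀ C : {C : Set ↥Sphere2 // IsPeripheralCircle S C},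
      periphOrbit S (homeoCyclic e) C = Subtype.val '' {C' | σ.SameCycle C C'} := by
    intro C
    ext C'
    constructor
    · rintro ⟨_, ⟨n, rfl⟩, rfl⟩
      exact ⟨(σ ^ n) C, ⟨n, rfl⟩, (setImage_homeoZPow S e n C).symm⟩
    · rintro ⟨_, ⟨n, rfl⟩, rfl⟩
      exact ⟨_, ⟨n, rfl⟩, (setImage_homeoZPow S e n C).symm⟩
  let f : Quotient (Equiv.Perm.SameCycle.setoid σ) → ↥(periphOrbitSet S (homeoCyclic e)) :=
    fun q => ⟨periphOrbit S (homeoCyclic e) q.out, q.out, q.out.2, rfl⟩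
  have hf : Function.Bijective f := by
    constructor
    · intro q q' h
      have h1 := congrArg Subtype.val h
      simp only [f, horb] at h1
      have h2 := (image_injective.2 Subtype.val_injective) h1
      have h3 : q'.out ∈ {C' | σ.SameCycle q.out C'} := by
        rw [h2]
        exact Equiv.Perm.SameCycle.refl _ _
      rw [← q.out_eq, ← q'.out_eq]
      exact Quotient.sound h3
    · rintro ⟨_, C, hC, rfl⟩
      refine ⟨Quotient.mk _ ⟨C, hC⟩, Subtype.ext ?_⟩
      have h1 : σ.SameCycle (Quotient.mk (Equiv.Perm.SameCycle.setoid σ) ⟨C, hC⟩).out ⟨C, hC⟩ :=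
        Quotient.mk_out (s := Equiv.Perm.SameCycle.setoid σ) _
      refine (horb _).trans (Eq.trans ?_ (horb ⟨C, hC⟩).symm)
      congr 1
      ext C'
      exact ⟨h1.symm.trans, h1.trans⟩
  rw [groupMass, cycleSum, ← (Equiv.ofBijective f hf).tsum_eq]
  refine tsum_congr fun q => ?_
  simp only [Equiv.ofBijective_apply, f, horb]
  refine le_antisymm (iSup₂_le ?_)
    (le_iSup₂_of_le _ ⟨q.out, Equiv.Perm.SameCycle.refl _ _, rfl⟩ le_rfl)
  rintro _ ⟨_, ⟨n, rfl⟩, rfl⟩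
  have := apply_zpow_of_invariant (r := fun C : {C // IsPeripheralCircle S C} => ρ C) hinv n q.out
  exact (congrArg (· ^ 2) this).le

end PeripheralAction

section Main

lemma setImage_eq_image {S : Set ↥Sphere2} {Ψ : ↥Sphere2 ≃ₜ ↥Sphere2} {ψ : ↥S ≃ₜ ↥S}
    (hψ : ∀ x : ↥S, (ψ x : ↥Sphere2) = Ψ x) {C : Set ↥Sphere2} (hC : C ⊆ S) :
    setImage S ψ C = Ψ '' C := by
  ext y
  constructor
  · rintro ⟨_, ⟨x, hx, rfl⟩, rfl⟩
    exact ⟨x, hx, (hψ x).symm⟩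
  · rintro ⟨x, hx, rfl⟩
    exact ⟨_, ⟨⟨x, hC hx⟩, hx, rfl⟩, hψ _⟩

lemma nonempty_image_map_inter_iff {S : Set ↥Sphere2} {Ψ : ↥Sphere2 ≃ₜ ↥Sphere2} {ψ : ↥S ≃ₜ ↥S}
    (hψ : ∀ x : ↥S, (ψ x : ↥Sphere2) = Ψ x) (γ : SpherePath)
    (C : {C : Set ↥Sphere2 // IsPeripheralCircle S C}) :
    ((γ.map Ψ).image ∩ (peripheralPerm S ψ C : Set ↥Sphere2)).Nonempty ↔
      (γ.image ∩ (C : Set ↥Sphere2)).Nonempty := by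
  have h1 : (γ.map Ψ).image = Ψ '' γ.image := image_comp Ψ γ.toFun γ.I
  have h2 : (peripheralPerm S ψ C : Set ↥Sphere2) = Ψ '' C := setImage_eq_image hψ C.2.1
  rw [h1, h2, ← image_inter Ψ.injective, image_nonempty]

lemma nonempty_image_iterate_map_inter_iff {S : Set ↥Sphere2} {Ψ : ↥Sphere2 ≃ₜ ↥Sphere2}
    {ψ : ↥S ≃ₜ ↥S} (hψ : ∀ x : ↥S, (ψ x : ↥Sphere2) = Ψ x) (γ : SpherePath)
    (C : {C : Set ↥Sphere2 // IsPeripheralCircle S C}) (i : ℕ) :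
    (((fun γ : SpherePath => γ.map Ψ)^[i] γ).image ∩
      (((peripheralPerm S ψ) ^ i) C : Set ↥Sphere2)).Nonempty ↔
        (γ.image ∩ (C : Set ↥Sphere2)).Nonempty := by
  induction i with
  | zero => rfl
  | succ i ih =>
    rw [Function.iterate_succ_apply', pow_succ', Equiv.Perm.mul_apply,
      nonempty_image_map_inter_iff hψ, ih]

lemma pathMassSum_eq_tsum_indicator (S : Set ↥Sphere2) (ρ : Set ↥Sphere2 → ℝ≥0∞)
    (γ : SpherePath) :
    pathMassSum S ρ γ = ∑' C : {C : Set ↥Sphere2 // IsPeripheralCircle S C},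
      {C : {C : Set ↥Sphere2 // IsPeripheralCircle S C} |
        (γ.image ∩ (C : Set ↥Sphere2)).Nonempty}.indicator (fun C => ρ C) C := by
  rw [pathMassSum, ← tsum_subtype, ← (Equiv.subtypeSubtypeEquivSubtypeInter
    (IsPeripheralCircle S) fun C => (γ.image ∩ C).Nonempty).tsum_eq]
  rfl

lemma pathMassSum_iterate_map {S : Set ↥Sphere2} {Ψ : ↥Sphere2 ≃ₜ ↥Sphere2}
    {ψ : ↥S ≃ₜ ↥S} (hψ : ∀ x : ↥S, (ψ x : ↥Sphere2) = Ψ x) (ρ : Set ↥Sphere2 → ℝ≥0∞)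
    (γ : SpherePath) (i : ℕ) :
    pathMassSum S ρ ((fun γ : SpherePath => γ.map Ψ)^[i] γ) =
      ∑' C : {C : Set ↥Sphere2 // IsPeripheralCircle S C},
        {C : {C : Set ↥Sphere2 // IsPeripheralCircle S C} |
          (γ.image ∩ (C : Set ↥Sphere2)).Nonempty}.indicator
            (fun C => ρ (((peripheralPerm S ψ) ^ i) C)) C := by
  rw [pathMassSum_eq_tsum_indicator, ← ((peripheralPerm S ψ) ^ i).tsum_eq]
  refine tsum_congr fun C => ?_
  classical
  simp only [indicator_apply, mem_ofPred_eq, nonempty_image_iterate_map_inter_iff hψ]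

lemma conformalModulus_preimage_iterate_map_eq_zero {Ψ : ↥Sphere2 ≃ₜ ↥Sphere2}
    (hQC : IsQuasiconformalOn Ψ univ univ) {Γ₀ : Set SpherePath} (h0 : conformalModulus Γ₀ = 0)
    (i : ℕ) :
    conformalModulus {γ : SpherePath | (fun γ : SpherePath => γ.map Ψ)^[i] γ ∈ Γ₀} = 0 := by
  induction i with
  | zero => exact h0
  | succ i ih =>
    simp only [Function.iterate_succ_apply]
    exact conformalModulus_preimage_map_eq_zero hQC
      (Γ₀ := {γ : SpherePath | (fun γ : SpherePath => γ.map Ψ)^[i] γ ∈ Γ₀}) ih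

lemma sum_range_shift_of_eq {k : ℕ} {u : ℕ → ℝ≥0∞} (h : u k = u 0) :
    ∑ i ∈ Finset.range k, u (i + 1) = ∑ i ∈ Finset.range k, u i := by
  cases k with
  | zero => rfl
  | succ k => rw [Finset.sum_range_succ, Finset.sum_range_succ' u, h]

lemma ENNReal.sq_inv_mul_sum_le {k : ℕ} (hk : 1 ≤ k) (z : ℕ → ℝ≥0∞) :
    ((k : ℝ≥0∞)⁻¹ * ∑ i ∈ Finset.range k, z i) ^ 2 ≤
      (k : ℝ≥0∞)⁻¹ * ∑ i ∈ Finset.range k, z i ^ 2 := by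
  have h1 : ∑ _i ∈ Finset.range k, (k : ℝ≥0∞)⁻¹ = 1 := by
    rw [Finset.sum_const, Finset.card_range, nsmul_eq_mul]
    exact ENNReal.mul_inv_cancel (by simp; omega) (ENNReal.natCast_ne_top k)
  have := ENNReal.rpow_arith_mean_le_arith_mean_rpow (Finset.range k) (fun _ => (k : ℝ≥0∞)⁻¹) z h1
    one_le_two
  simpa only [Finset.mul_sum, ENNReal.rpow_two] using this

lemma groupCarpetModulus_le {S : Set ↥Sphere2} {G : Set (↥S ≃ₜ ↥S)} {Γ : Set SpherePath}
    {ρ : Set ↥Sphere2 → ℝ≥0∞} (hρ : InvariantMass S G ρ) (hadm : CarpetAdmissible S Γ ρ) :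
    groupCarpetModulus S G Γ ≤ groupMass S G ρ :=
  iInf_le_of_le ρ (iInf_le_of_le hρ (iInf_le_of_le hadm le_rfl))

lemma groupCarpetModulus_pow_le {S : Set ↥Sphere2} (ψ : ↥S ≃ₜ ↥S) (Γ : Set SpherePath) {k : ℕ}
    (hk : 1 ≤ k) :
    groupCarpetModulus S (homeoCyclic (homeoPow ψ k)) Γ ≤
      (k : ℝ≥0∞) * groupCarpetModulus S (homeoCyclic ψ) Γ := by
  have hk0 : (k : ℝ≥0∞) ≠ 0 := by simp; omega
  have hkt : (k : ℝ≥0∞) ≠ ⊤ := ENNReal.natCast_ne_top k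
  rw [mul_comm, ← ENNReal.div_le_iff_le_mul (Or.inl hk0) (Or.inl hkt)]
  refine le_iInf fun ρ => le_iInf fun hρ => le_iInf fun hadm => ?_
  rw [ENNReal.div_le_iff_le_mul (Or.inl hk0) (Or.inl hkt), mul_comm]
  have hinv := invariantMass_homeoCyclic_iff.1 hρ
  have hρk : InvariantMass S (homeoCyclic (homeoPow ψ k)) ρ := by
    refine invariantMass_homeoCyclic_iff.2 fun C => ?_
    rw [homeoPow_eq_pow, map_pow, ← zpow_natCast]
    exact apply_zpow_of_invariant (r := fun C : {C // IsPeripheralCircle S C} => ρ C) hinv k C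
  refine (groupCarpetModulus_le hρk hadm).trans ?_
  rw [groupMass_homeoCyclic hρ, groupMass_homeoCyclic hρk, homeoPow_eq_pow, map_pow]
  exact cycleSum_pow_le (fun C => by rw [hinv C]) hk

/-- The average of the mass distribution `ρ` over `ψ⁰, …, ψᵏ⁻¹`, cut off to the sets that meet
some path in `Γ`. -/
noncomputable def averagedMass (S : Set ↥Sphere2) (ψ : ↥S ≃ₜ ↥S) (Γ : Set SpherePath) (k : ℕ)
    (ρ : Set ↥Sphere2 → ℝ≥0∞) : Set ↥Sphere2 → ℝ≥0∞ :=
  {C | ∃ γ ∈ Γ, (γ.image ∩ C).Nonempty}.indicator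
    fun C => (k : ℝ≥0∞)⁻¹ * ∑ i ∈ Finset.range k, ρ (setImage S (ψ ^ i) C)

lemma setImage_pow (S : Set ↥Sphere2) (ψ : ↥S ≃ₜ ↥S) (i : ℕ)
    (C : {C : Set ↥Sphere2 // IsPeripheralCircle S C}) :
    setImage S (ψ ^ i) C = ((peripheralPerm S ψ ^ i) C : {C // IsPeripheralCircle S C}) := by
  rw [← map_pow]
  rfl

lemma invariantMass_averagedMass {S : Set ↥Sphere2} {Ψ : ↥Sphere2 ≃ₜ ↥Sphere2} {ψ : ↥S ≃ₜ ↥S}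
    (hψ : ∀ x : ↥S, (ψ x : ↥Sphere2) = Ψ x) {Γ : Set SpherePath}
    (hinv : (fun γ : SpherePath => γ.map Ψ) '' Γ = Γ) {k : ℕ} {ρ : Set ↥Sphere2 → ℝ≥0∞}
    (hρ : InvariantMass S (homeoCyclic (homeoPow ψ k)) ρ) :
    InvariantMass S (homeoCyclic ψ) (averagedMass S ψ Γ k ρ) := by
  classical
  refine invariantMass_homeoCyclic_iff.2 fun C => ?_
  have hmeet : (∃ γ ∈ Γ, (γ.image ∩ (peripheralPerm S ψ C : Set ↥Sphere2)).Nonempty) ↔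
      ∃ γ ∈ Γ, (γ.image ∩ (C : Set ↥Sphere2)).Nonempty := by
    conv_lhs => rw [← hinv]
    simp only [exists_mem_image, nonempty_image_map_inter_iff hψ]
  have hsum := sum_range_shift_of_eq (k := k)
    (u := fun i => ρ ((peripheralPerm S ψ ^ i) C : {C // IsPeripheralCircle S C})) <| by
      have := invariantMass_homeoCyclic_iff.1 hρ C
      rwa [homeoPow_eq_pow, map_pow] at this
  simp only [averagedMass, indicator_apply, mem_ofPred_eq, hmeet, setImage_pow, ← hsum, pow_succ,
    Equiv.Perm.mul_apply]

lemma carpetAdmissible_averagedMass {S : Set ↥Sphere2} {Ψ : ↥Sphere2 ≃ₜ ↥Sphere2}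
    (hQC : IsQuasiconformalOn Ψ univ univ) {ψ : ↥S ≃ₜ ↥S}
    (hψ : ∀ x : ↥S, (ψ x : ↥Sphere2) = Ψ x) {Γ : Set SpherePath}
    (hinv : (fun γ : SpherePath => γ.map Ψ) '' Γ = Γ) {k : ℕ} (hk : 1 ≤ k)
    {ρ : Set ↥Sphere2 → ℝ≥0∞} (hρ : CarpetAdmissible S Γ ρ) :
    CarpetAdmissible S Γ (averagedMass S ψ Γ k ρ) := by
  obtain ⟨Γ₀, -, h0, hadm⟩ := hρ
  set F : SpherePath → SpherePath := fun γ => γ.map Ψ with hF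
  have hFΓ : ∀ i, ∀ γ ∈ Γ, F^[i] γ ∈ Γ := fun i γ hγ =>
    (mapsTo_iff_image_subset.2 hinv.subset).iterate i hγ
  refine ⟨{γ ∈ Γ | ∃ i < k, F^[i] γ ∈ Γ₀}, sep_subset _ _, ?_, ?_⟩
  · refine conformalModulus_eq_zero_of_subset ?_ (conformalModulus_biUnion_eq_zero (Finset.range k)
      (fun i => {γ | F^[i] γ ∈ Γ₀})
      fun i _ => conformalModulus_preimage_iterate_map_eq_zero hQC h0 i)
    rintro γ ⟨-, i, hi, hγ⟩
    exact mem_biUnion (Finset.mem_coe.2 (Finset.mem_range.2 hi)) hγ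
  rintro γ ⟨hγ, hγ₀⟩
  have hone : ∀ i < k, 1 ≤ pathMassSum S ρ (F^[i] γ) := fun i hi =>
    hadm _ ⟨hFΓ i γ hγ, fun h => hγ₀ ⟨hγ, i, hi, h⟩⟩
  have heq : pathMassSum S (averagedMass S ψ Γ k ρ) γ =
      (k : ℝ≥0∞)⁻¹ * ∑ i ∈ Finset.range k, pathMassSum S ρ (F^[i] γ) := by
    classical
    simp only [hF, pathMassSum_iterate_map hψ]
    rw [pathMassSum_eq_tsum_indicator, ← Summable.tsum_finsetSum fun _ _ => ENNReal.summable,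
      ← ENNReal.tsum_mul_left]
    refine tsum_congr fun C => ?_
    by_cases h : (γ.image ∩ (C : Set ↥Sphere2)).Nonempty
    · have h' : ∃ γ ∈ Γ, (γ.image ∩ (C : Set ↥Sphere2)).Nonempty := ⟨γ, hγ, h⟩
      simp only [averagedMass, indicator_apply, mem_ofPred_eq, h, h', if_true, setImage_pow]
    · simp [h]
  rw [heq]
  calc (1 : ℝ≥0∞) = (k : ℝ≥0∞)⁻¹ * ∑ _i ∈ Finset.range k, 1 := by
        rw [Finset.sum_const, Finset.card_range, nsmul_one]
        exact (ENNReal.inv_mul_cancel (by simp; omega) (ENNReal.natCast_ne_top k)).symm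
    _ ≤ _ := by
        gcongr with i hi
        exact hone i (Finset.mem_range.1 hi)

lemma mul_groupMass_averagedMass_le {S : Set ↥Sphere2} {Ψ : ↥Sphere2 ≃ₜ ↥Sphere2} {ψ : ↥S ≃ₜ ↥S}
    (hψ : ∀ x : ↥S, (ψ x : ↥Sphere2) = Ψ x) {Γ : Set SpherePath}
    (hinv : (fun γ : SpherePath => γ.map Ψ) '' Γ = Γ)
    (hfree : ∀ C : Set ↥Sphere2, IsPeripheralCircle S C →
      (∃ γ ∈ Γ, (γ.image ∩ C).Nonempty) →
      ∀ n : ℤ, n ≠ 0 → setImage S (homeoZPow ψ n) C ≠ C)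
    {k : ℕ} (hk : 1 ≤ k) {ρ : Set ↥Sphere2 → ℝ≥0∞}
    (hρ : InvariantMass S (homeoCyclic (homeoPow ψ k)) ρ) :
    k * groupMass S (homeoCyclic ψ) (averagedMass S ψ Γ k ρ) ≤
      groupMass S (homeoCyclic (homeoPow ψ k)) ρ := by
  have hρk := invariantMass_homeoCyclic_iff.1 hρ
  rw [groupMass_homeoCyclic (invariantMass_averagedMass hψ hinv hρ), groupMass_homeoCyclic hρ]
  rw [homeoPow_eq_pow, map_pow] at hρk ⊢
  refine le_trans ?_ (cycleSum_indicator_le (σ := peripheralPerm S ψ) (k := k)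
    (r := fun C : {C // IsPeripheralCircle S C} => ρ C ^ 2) (fun C => by rw [hρk C])
    (F := {C : {C // IsPeripheralCircle S C} |
      ∃ γ ∈ Γ, (γ.image ∩ (C : Set ↥Sphere2)).Nonempty}) fun C hC n hn h => ?_)
  · rw [cycleSum, cycleSum, ← ENNReal.tsum_mul_left]
    refine ENNReal.tsum_le_tsum fun q => ?_
    by_cases hq : ∃ γ ∈ Γ, (γ.image ∩ (q.out : Set ↥Sphere2)).Nonempty
    · rw [indicator_of_mem (by exact hq), averagedMass, indicator_of_mem (by exact hq)]
      refine (mul_le_mul_right (ENNReal.sq_inv_mul_sum_le hk _) _).trans_eq ?_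
      rw [← mul_assoc, ENNReal.mul_inv_cancel (by simp; omega) (ENNReal.natCast_ne_top k), one_mul]
      simp only [setImage_pow]
    · rw [averagedMass, indicator_of_notMem (by exact hq)]
      simp
  · refine hfree C C.2 hC n hn ?_
    rw [setImage_homeoZPow, h]

end Main

/-- **Carpet modulus with respect to powers of a map** (Lemma 3.3).
Let `S` be a carpet in `S²`, `Ψ : S² → S²` a quasiconformal homeomorphism with
`Ψ(S) = S`, and `ψ := Ψ|_S`.  Suppose `Γ` is a `Ψ`-invariant path family in `S²` such
that `ψⁿ(C) ≠ C` for every peripheral circle `C` of `S` meeting some path of `Γ` and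
every integer `n ≠ 0`.  Then `mod_{S/⟨ψᵏ⟩}(Γ) = k · mod_{S/⟨ψ⟩}(Γ)` for every `k ≥ 1`. -/
theorem groupCarpetModulus_pow_cyclic (S : Set ↥Sphere2) (hS : IsCarpet S)
    (Ψ : ↥Sphere2 ≃ₜ ↥Sphere2) (hQC : IsQuasiconformalOn ⇑Ψ Set.univ Set.univ)
    (hΨS : ⇑Ψ '' S = S) (ψ : ↥S ≃ₜ ↥S) (hψ : ∀ x : ↥S, (ψ x : ↥Sphere2) = Ψ ↑x)
    (Γ : Set SpherePath) (hinv : (fun γ : SpherePath => γ.map Ψ) '' Γ = Γ)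
    (hfree : ∀ C : Set ↥Sphere2, IsPeripheralCircle S C →
      (∃ γ ∈ Γ, (γ.image ∩ C).Nonempty) →
      ∀ n : ℤ, n ≠ 0 → setImage S (homeoZPow ψ n) C ≠ C)
    (k : ℕ) (hk : 1 ≤ k) :
    groupCarpetModulus S (homeoCyclic (homeoPow ψ k)) Γ =
      (k : ℝ≥0∞) * groupCarpetModulus S (homeoCyclic ψ) Γ := by
  refine le_antisymm (groupCarpetModulus_pow_le ψ Γ hk) ?_
  refine le_iInf fun ρ => le_iInf fun hρ => le_iInf fun hadm => ?_
  exact (mul_le_mul_right (groupCarpetModulus_le (invariantMass_averagedMass hψ hinv hρ)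
    (carpetAdmissible_averagedMass hQC hψ hinv hk hadm)) _).trans
    (mul_groupMass_averagedMass_le hψ hinv hfree hk hρ)
end

section
/- Let p ≥ 3 be odd and let C and C' be two distinct peripheral circles of S_p (each a square, with Euclidean side lengths ℓ(C) and ℓ(C'), where ℓ(O) = 1 for the outer square O). Then for their Euclidean distance, dist(C, C') ≥ ((p−1)/2) · min{ℓ(C), ℓ(C')}; in particular, the family of peripheral circles of S_p is uniformly relatively separated in the Euclidean metric with constant δ = (p−1)/(2√2), i.e., dist(C,C')/min{diam C, diam C'} ≥ (p−1)/(2√2) for all distinct peripheral circles C, C'. -/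
open Set Metric

/-- Lower-left corners of the kept closed squares of side length `p^{-n}` in the `n`-th
step of the construction of `S_p`. -/
def keptCorners (p : ℕ) : ℕ → Set ℂ
  | 0 => {0}
  | n + 1 => {z : ℂ | ∃ w ∈ keptCorners p n, ∃ i j : ℕ, i < p ∧ j < p ∧
      ¬(i = (p - 1) / 2 ∧ j = (p - 1) / 2) ∧
      z = w + ((i : ℂ) + (j : ℂ) * Complex.I) / (p : ℂ) ^ (n + 1)}

/-- The peripheral squares of `S_p`, encoded as pairs (lower-left corner, side length):
the outer square `O = ∂([0,1]²)` together with the boundaries of all removed middle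
squares.  The pair `((c,l))` corresponds to the square `squareBoundary c l`. -/
def peripheralSquares (p : ℕ) : Set (ℂ × ℝ) :=
  {((0 : ℂ), (1 : ℝ))} ∪
  {x : ℂ × ℝ | ∃ n : ℕ, ∃ w ∈ keptCorners p n,
    x = (w + ((((p - 1) / 2 : ℕ) : ℂ) * (1 + Complex.I)) / (p : ℂ) ^ (n + 1),
          (1 : ℝ) / (p : ℝ) ^ (n + 1))}

/-- The distance `dist(A,B) = inf{|a-b| : a ∈ A, b ∈ B}` between two subsets of the
plane. -/
noncomputable def setDist (A B : Set ℂ) : ℝ := sInf (Set.image2 dist A B)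

/-- The corners of the kept squares of level `n` lie on the grid of mesh `p⁻ⁿ`. -/
lemma exists_int_of_mem_keptCorners {p : ℕ} (hp : p ≠ 0) {n : ℕ} {w : ℂ}
    (hw : w ∈ keptCorners p n) : ∃ a b : ℤ, w.re * (p : ℝ) ^ n = a ∧ w.im * (p : ℝ) ^ n = b := by
  have hp' : (p : ℝ) ≠ 0 := by exact_mod_cast hp
  induction n generalizing w with
  | zero =>
    obtain rfl : w = 0 := hw
    exact ⟨0, 0, by simp, by simp⟩
  | succ n ih =>
    obtain ⟨v, hv, i, j, -, -, -, rfl⟩ := hw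
    obtain ⟨a, b, ha, hb⟩ := ih hv
    have hcast : (p : ℂ) ^ (n + 1) = (((p : ℝ) ^ (n + 1) : ℝ) : ℂ) := by push_cast; rfl
    refine ⟨a * p + i, b * p + j, ?_, ?_⟩
    · rw [hcast, Complex.add_re, Complex.div_ofReal_re]
      push_cast
      rw [← ha]
      simp
      field_simp
      ring
    · rw [hcast, Complex.add_im, Complex.div_ofReal_im]
      push_cast
      rw [← hb]
      simp
      field_simp
      ring

/-- The square with corner `c` and side `l` is the middle part, of side `p⁻⁽ⁿ⁺¹⁾`, of the cell with
index `(a, b)` of the grid of mesh `p⁻ⁿ`. -/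
def IsMiddleSquare (p n : ℕ) (a b : ℤ) (c : ℂ) (l : ℝ) : Prop :=
  c.re * (p : ℝ) ^ n = a + (1 / 2 - 1 / (2 * p)) ∧
    c.im * (p : ℝ) ^ n = b + (1 / 2 - 1 / (2 * p)) ∧ l = 1 / (p : ℝ) ^ (n + 1)

lemma eq_outer_or_isMiddleSquare {p : ℕ} (hodd : Odd p) {c : ℂ} {l : ℝ}
    (h : (c, l) ∈ peripheralSquares p) :
    (c = 0 ∧ l = 1) ∨ ∃ n a b, IsMiddleSquare p n a b c l := by
  rcases h with h | ⟨n, w, hw, h⟩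
  · exact Or.inl (Prod.mk.inj h)
  · right
    obtain ⟨rfl, rfl⟩ := Prod.mk.inj h
    have hp : p ≠ 0 := hodd.pos.ne'
    have hp' : (p : ℝ) ≠ 0 := by exact_mod_cast hp
    obtain ⟨a, b, ha, hb⟩ := exists_int_of_mem_keptCorners hp hw
    have hcast : (p : ℂ) ^ (n + 1) = (((p : ℝ) ^ (n + 1) : ℝ) : ℂ) := by push_cast; rfl
    have hk : (((p - 1) / 2 : ℕ) : ℝ) = ((p : ℝ) - 1) / 2 := by
      obtain ⟨k, rfl⟩ := hodd
      simp
    refine ⟨n, a, b, ?_, ?_, rfl⟩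
    · rw [hcast, Complex.add_re, Complex.div_ofReal_re, add_mul, ha]
      simp [-Nat.cast_div_charZero, hk]
      field_simp
      ring
    · rw [hcast, Complex.add_im, Complex.div_ofReal_im, add_mul, hb]
      simp [-Nat.cast_div_charZero, hk]
      field_simp
      ring

lemma mem_squareBoundary_edge {c z : ℂ} {l : ℝ} (hz : z ∈ squareBoundary c l) :
    (z.re = c.re ∨ z.re = c.re + l) ∨ (z.im = c.im ∨ z.im = c.im + l) := by
  have edge {x s : ℝ} (h : |x - (s + l / 2)| = l / 2) : x = s ∨ x = s + l := by
    rcases abs_choice (x - (s + l / 2)) with h' | h' <;> rw [h'] at h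
    · right; linarith
    · left; linarith
  have hz : max _ _ = l / 2 := hz
  rcases max_choice |z.re - (c.re + l / 2)| |z.im - (c.im + l / 2)| with h | h
  · exact Or.inl (edge (h ▸ hz))
  · exact Or.inr (edge (h ▸ hz))

/-- The square with corner `c` and side `l` runs along the lines of the grid of mesh
`p⁻ⁿ`. -/
def OnGrid (p n : ℕ) (c : ℂ) (l : ℝ) : Prop :=
  ∃ A B L : ℤ, c.re * (p : ℝ) ^ n = A ∧ c.im * (p : ℝ) ^ n = B ∧ l * (p : ℝ) ^ n = L

lemma onGrid_outer (p n : ℕ) : OnGrid p n 0 1 :=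
  ⟨0, 0, (p : ℤ) ^ n, by simp, by simp, by simp⟩

lemma IsMiddleSquare.onGrid {p m n : ℕ} {a b : ℤ} {c : ℂ} {l : ℝ} (hodd : Odd p)
    (h : IsMiddleSquare p m a b c l) (hmn : m < n) : OnGrid p n c l := by
  have hp' : (p : ℝ) ≠ 0 := by exact_mod_cast hodd.pos.ne'
  obtain ⟨d, rfl⟩ := Nat.exists_eq_add_of_lt hmn
  obtain ⟨ha, hb, rfl⟩ := h
  obtain ⟨k, hk⟩ := hodd
  have hk' : (p : ℝ) = 2 * k + 1 := by exact_mod_cast hk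
  have hmid : (1 / 2 - 1 / (2 * p) : ℝ) * p = k := by
    field_simp
    linarith
  have hpow : (p : ℝ) ^ (m + d + 1) = p ^ m * (p * p ^ d) := by ring
  refine ⟨(a * p + k) * p ^ d, (b * p + k) * p ^ d, p ^ d, ?_, ?_, ?_⟩
  · rw [hpow, ← mul_assoc, ha]
    push_cast
    linear_combination (p : ℝ) ^ d * hmid
  · rw [hpow, ← mul_assoc, hb]
    push_cast
    linear_combination (p : ℝ) ^ d * hmid
  · push_cast
    field_simp
    ring

lemma abs_sub_le_of_mem_squareBoundary {c z : ℂ} {l : ℝ} (hz : z ∈ squareBoundary c l) :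
    |z.re - (c.re + l / 2)| ≤ l / 2 ∧ |z.im - (c.im + l / 2)| ≤ l / 2 :=
  max_le_iff.mp (le_of_eq hz)

/-- The scaled coordinates of a point of a middle square are close to the center of its cell. -/
lemma IsMiddleSquare.abs_sub_le {p n : ℕ} {a b : ℤ} {c z : ℂ} {l : ℝ} (hp : p ≠ 0)
    (h : IsMiddleSquare p n a b c l) (hz : z ∈ squareBoundary c l) :
    |z.re * (p : ℝ) ^ n - (a + 1 / 2)| ≤ 1 / (2 * p) ∧
      |z.im * (p : ℝ) ^ n - (b + 1 / 2)| ≤ 1 / (2 * p) := by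
  have hp' : (0 : ℝ) < p := by exact_mod_cast hp.bot_lt
  obtain ⟨ha, hb, rfl⟩ := h
  have hq : (0 : ℝ) < p ^ n := by positivity
  have scale {x s : ℝ} {a : ℤ} (hs : s * (p : ℝ) ^ n = a + (1 / 2 - 1 / (2 * p)))
      (hx : |x - (s + 1 / (p : ℝ) ^ (n + 1) / 2)| ≤ 1 / (p : ℝ) ^ (n + 1) / 2) :
      |x * (p : ℝ) ^ n - (a + 1 / 2)| ≤ 1 / (2 * p) := by
    have hl : 1 / (p : ℝ) ^ (n + 1) / 2 * p ^ n = 1 / (2 * p) := by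
      field_simp
      ring
    have := mul_le_mul_of_nonneg_right hx hq.le
    nth_rw 1 [← abs_of_pos hq] at this
    rw [hl, ← abs_mul] at this
    have hcenter : x * (p : ℝ) ^ n - (a + 1 / 2) =
        (x - (s + 1 / (p : ℝ) ^ (n + 1) / 2)) * (p : ℝ) ^ n := by
      linear_combination hs + hl
    rwa [hcenter]
  obtain ⟨h₁, h₂⟩ := abs_sub_le_of_mem_squareBoundary hz
  exact ⟨scale ha h₁, scale hb h₂⟩

lemma le_dist_of_coordinate {p n : ℕ} (hp : p ≠ 0) {u z : ℂ}
    (h : (1 / 2 - 1 / (2 * p) : ℝ) ≤ |u.re * (p : ℝ) ^ n - z.re * (p : ℝ) ^ n| ∨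
      (1 / 2 - 1 / (2 * p) : ℝ) ≤ |u.im * (p : ℝ) ^ n - z.im * (p : ℝ) ^ n|) :
    ((p : ℝ) - 1) / 2 * (1 / (p : ℝ) ^ (n + 1)) ≤ dist u z := by
  have hp' : (0 : ℝ) < p := by exact_mod_cast hp.bot_lt
  have hq : (0 : ℝ) < p ^ n := by positivity
  have key {x y : ℝ} (h : (1 / 2 - 1 / (2 * p) : ℝ) ≤ |x * (p : ℝ) ^ n - y * (p : ℝ) ^ n|) :
      ((p : ℝ) - 1) / 2 * (1 / (p : ℝ) ^ (n + 1)) ≤ |x - y| := by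
    rw [← sub_mul, abs_mul, abs_of_pos hq, ← div_le_iff₀ hq] at h
    refine le_of_eq_of_le ?_ h
    rw [pow_succ]
    field_simp
  rw [Complex.dist_eq]
  rcases h with h | h
  · exact (key h).trans (by simpa using Complex.abs_re_le_norm (u - z))
  · exact (key h).trans (by simpa using Complex.abs_im_le_norm (u - z))

lemma half_le_abs_int_sub (k a : ℤ) : (1 / 2 : ℝ) ≤ |(k : ℝ) - (a + 1 / 2)| := by
  rcases le_or_gt k a with h | h
  · have : (k : ℝ) ≤ a := by exact_mod_cast h
    exact le_abs.mpr (Or.inr (by linarith))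
  · have : (a : ℝ) + 1 ≤ k := by exact_mod_cast h
    exact le_abs.mpr (Or.inl (by linarith))

/-- A middle square of level `n` is far from every square running along the grid of mesh `p⁻ⁿ`. -/
lemma IsMiddleSquare.le_dist_of_onGrid {p n : ℕ} {a b : ℤ} {c c' u z : ℂ} {l l' : ℝ} (hp : p ≠ 0)
    (h : IsMiddleSquare p n a b c l) (h' : OnGrid p n c' l')
    (hu : u ∈ squareBoundary c l) (hz : z ∈ squareBoundary c' l') :
    ((p : ℝ) - 1) / 2 * l ≤ dist u z := by
  obtain ⟨h₁, h₂⟩ := h.abs_sub_le hp hu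
  obtain ⟨-, -, rfl⟩ := h
  obtain ⟨A, B, L, hA, hB, hL⟩ := h'
  have key {x y : ℝ} {a : ℤ} (hx : |x - (a + 1 / 2)| ≤ 1 / (2 * p)) (hy : ∃ k : ℤ, y = k) :
      (1 / 2 - 1 / (2 * p) : ℝ) ≤ |x - y| := by
    obtain ⟨k, rfl⟩ := hy
    have := _root_.abs_sub_le (k : ℝ) x (a + 1 / 2)
    rw [abs_sub_comm (k : ℝ) x] at this
    linarith [half_le_abs_int_sub k a]
  apply le_dist_of_coordinate hp
  rcases mem_squareBoundary_edge hz with hz | hz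
  · left
    refine key h₁ ?_
    rcases hz with hz | hz
    · exact ⟨A, by rw [hz, hA]⟩
    · exact ⟨A + L, by rw [hz, add_mul, hA, hL]; push_cast; rfl⟩
  · right
    refine key h₂ ?_
    rcases hz with hz | hz
    · exact ⟨B, by rw [hz, hB]⟩
    · exact ⟨B + L, by rw [hz, add_mul, hB, hL]; push_cast; rfl⟩

/-- Two distinct middle squares of the same level are far apart. -/
lemma IsMiddleSquare.le_dist_of_ne {p n : ℕ} {a b a' b' : ℤ} {c c' u z : ℂ} {l l' : ℝ}
    (hp : p ≠ 0) (h : IsMiddleSquare p n a b c l) (h' : IsMiddleSquare p n a' b' c' l')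
    (hne : (c, l) ≠ (c', l')) (hu : u ∈ squareBoundary c l) (hz : z ∈ squareBoundary c' l') :
    ((p : ℝ) - 1) / 2 * l ≤ dist u z := by
  have hp' : (1 : ℝ) ≤ p := by exact_mod_cast hp.bot_lt
  have hq : (p : ℝ) ^ n ≠ 0 := by positivity
  have hinv : (1 / (2 * p) : ℝ) ≤ 1 / 2 := by
    apply one_div_le_one_div_of_le <;> linarith
  have hab : a ≠ a' ∨ b ≠ b' := by
    by_contra! hab
    obtain ⟨rfl, rfl⟩ := hab
    apply hne
    rw [h.2.2, h'.2.2, Prod.mk.injEq]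
    exact ⟨Complex.ext (mul_right_cancel₀ hq (h.1.trans h'.1.symm))
      (mul_right_cancel₀ hq (h.2.1.trans h'.2.1.symm)), rfl⟩
  obtain ⟨h₁, h₂⟩ := h.abs_sub_le hp hu
  obtain ⟨h₁', h₂'⟩ := h'.abs_sub_le hp hz
  obtain ⟨-, -, rfl⟩ := h
  have key {x y : ℝ} {a a' : ℤ} (hx : |x - (a + 1 / 2)| ≤ 1 / (2 * p))
      (hy : |y - (a' + 1 / 2)| ≤ 1 / (2 * p)) (ha : a ≠ a') :
      (1 / 2 - 1 / (2 * p) : ℝ) ≤ |x - y| := by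
    rw [abs_le] at hx hy
    rcases lt_or_gt_of_ne ha with h | h
    · have : (a : ℝ) + 1 ≤ a' := by exact_mod_cast h
      exact le_abs.mpr (Or.inr (by linarith))
    · have : (a' : ℝ) + 1 ≤ a := by exact_mod_cast h
      exact le_abs.mpr (Or.inl (by linarith))
  apply le_dist_of_coordinate hp
  exact hab.imp (key h₁ h₁') (key h₂ h₂')

lemma mul_min_le_dist {p : ℕ} (hodd : Odd p) {c c' u z : ℂ} {l l' : ℝ}
    (h1 : (c, l) ∈ peripheralSquares p) (h2 : (c', l') ∈ peripheralSquares p)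
    (hne : (c, l) ≠ (c', l')) (hu : u ∈ squareBoundary c l) (hz : z ∈ squareBoundary c' l') :
    ((p : ℝ) - 1) / 2 * min l l' ≤ dist u z := by
  have hp : p ≠ 0 := hodd.pos.ne'
  have hp' : (1 : ℝ) ≤ p := by exact_mod_cast hodd.pos
  have hk : 0 ≤ ((p : ℝ) - 1) / 2 := by linarith
  have left (h : ((p : ℝ) - 1) / 2 * l ≤ dist u z) : ((p : ℝ) - 1) / 2 * min l l' ≤ dist u z :=
    (mul_le_mul_of_nonneg_left (min_le_left _ _) hk).trans h
  have right (h : ((p : ℝ) - 1) / 2 * l' ≤ dist z u) : ((p : ℝ) - 1) / 2 * min l l' ≤ dist u z :=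
    (mul_le_mul_of_nonneg_left (min_le_right _ _) hk).trans (dist_comm z u ▸ h)
  rcases eq_outer_or_isMiddleSquare hodd h1 with ⟨rfl, rfl⟩ | ⟨n, a, b, h⟩ <;>
    rcases eq_outer_or_isMiddleSquare hodd h2 with ⟨rfl, rfl⟩ | ⟨m, a', b', h'⟩
  · exact absurd rfl hne
  · exact right (h'.le_dist_of_onGrid hp (onGrid_outer p m) hz hu)
  · exact left (h.le_dist_of_onGrid hp (onGrid_outer p n) hu hz)
  · rcases lt_trichotomy m n with hmn | rfl | hmn
    · exact left (h.le_dist_of_onGrid hp (h'.onGrid hodd hmn) hu hz)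
    · exact left (h.le_dist_of_ne hp h' hne hu hz)
    · exact right (h'.le_dist_of_onGrid hp (h.onGrid hodd hmn) hz hu)

lemma side_pos_of_mem_peripheralSquares {p : ℕ} (hodd : Odd p) {c : ℂ} {l : ℝ}
    (h : (c, l) ∈ peripheralSquares p) : 0 < l := by
  have hp : (0 : ℝ) < p := by exact_mod_cast hodd.pos
  rcases eq_outer_or_isMiddleSquare hodd h with ⟨-, rfl⟩ | ⟨n, a, b, -, -, rfl⟩ <;> positivity

lemma corner_mem_squareBoundary (c : ℂ) {l : ℝ} (hl : 0 ≤ l) : c ∈ squareBoundary c l := by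
  simpa [squareBoundary] using div_nonneg hl zero_le_two

lemma opposite_corner_mem_squareBoundary (c : ℂ) {l : ℝ} (hl : 0 ≤ l) :
    c + l * (1 + Complex.I) ∈ squareBoundary c l := by
  have h (x : ℝ) : x + l - (x + l / 2) = l / 2 := by ring
  simpa [squareBoundary, h] using div_nonneg hl zero_le_two

lemma dist_le_of_mem_squareBoundary {c u z : ℂ} {l : ℝ}
    (hu : u ∈ squareBoundary c l) (hz : z ∈ squareBoundary c l) : dist u z ≤ √2 * l := by
  obtain ⟨h₁, h₂⟩ := abs_sub_le_of_mem_squareBoundary hu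
  obtain ⟨h₁', h₂'⟩ := abs_sub_le_of_mem_squareBoundary hz
  rw [abs_le] at h₁ h₂ h₁' h₂'
  have hre : |u.re - z.re| ≤ l := abs_le.mpr ⟨by linarith, by linarith⟩
  have him : |u.im - z.im| ≤ l := abs_le.mpr ⟨by linarith, by linarith⟩
  rw [Complex.dist_eq]
  refine (Complex.norm_le_sqrt_two_mul_max (u - z)).trans ?_
  gcongr
  exact max_le (by simpa using hre) (by simpa using him)

lemma diam_squareBoundary (c : ℂ) {l : ℝ} (hl : 0 ≤ l) :
    Metric.diam (squareBoundary c l) = √2 * l := by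
  apply le_antisymm
  · exact Metric.diam_le_of_forall_dist_le (by positivity)
      fun u hu z hz => dist_le_of_mem_squareBoundary hu hz
  · have hb : Bornology.IsBounded (squareBoundary c l) :=
      Metric.isBounded_iff.mpr ⟨_, fun u hu z hz => dist_le_of_mem_squareBoundary hu hz⟩
    refine le_of_eq_of_le ?_ (Metric.dist_le_diam_of_mem hb
      (opposite_corner_mem_squareBoundary c hl) (corner_mem_squareBoundary c hl))
    have hI : ‖(1 + Complex.I : ℂ)‖ = √2 := by
      rw [Complex.norm_def, Complex.normSq_apply]
      norm_num
    rw [Complex.dist_eq, add_sub_cancel_left, norm_mul, hI, Complex.norm_real, Real.norm_eq_abs,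
      abs_of_nonneg hl, mul_comm]

/-- **Uniform relative separation of the peripheral circles of `S_p`**.
If `C` and `C'` are distinct peripheral circles (squares) of `S_p` with side lengths
`ℓ(C)` and `ℓ(C')`, then `dist(C,C') ≥ ((p-1)/2)·min{ℓ(C),ℓ(C')}`; consequently
`dist(C,C')/min{diam C, diam C'} ≥ (p-1)/(2√2)`. -/
theorem peripheral_circles_uniformly_relatively_separated (p : ℕ) (hp : 3 ≤ p)
    (hodd : Odd p) (c c' : ℂ) (l l' : ℝ)
    (h1 : (c, l) ∈ peripheralSquares p) (h2 : (c', l') ∈ peripheralSquares p)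
    (hne : (c, l) ≠ (c', l')) :
    ((p : ℝ) - 1) / 2 * min l l' ≤ setDist (squareBoundary c l) (squareBoundary c' l') ∧
    ((p : ℝ) - 1) / (2 * Real.sqrt 2) ≤
      setDist (squareBoundary c l) (squareBoundary c' l') /
        min (Metric.diam (squareBoundary c l)) (Metric.diam (squareBoundary c' l')) := by
  have hl := side_pos_of_mem_peripheralSquares hodd h1
  have hl' := side_pos_of_mem_peripheralSquares hodd h2
  have hsep : ((p : ℝ) - 1) / 2 * min l l' ≤
      setDist (squareBoundary c l) (squareBoundary c' l') := by
    refine le_csInf ⟨_, Set.mem_image2_of_mem (corner_mem_squareBoundary c hl.le)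
      (corner_mem_squareBoundary c' hl'.le)⟩ ?_
    rintro _ ⟨u, hu, z, hz, rfl⟩
    exact mul_min_le_dist hodd h1 h2 hne hu hz
  refine ⟨hsep, ?_⟩
  have hs : (0 : ℝ) < √2 := by positivity
  rw [diam_squareBoundary c hl.le, diam_squareBoundary c' hl'.le,
    ← mul_min_of_nonneg _ _ hs.le, le_div_iff₀ (mul_pos hs (lt_min hl hl'))]
  refine le_of_eq_of_le ?_ hsep
  field_simp
end
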